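/- Let G = W(H4) ⊂ GL₄(ℝ) be the Weyl group of type H4 (generated by the four explicit matrices below). The real vector space of G-invariant homogeneous polynomials of degree 72 in ℝ[x,y,z,w] that vanish to order at least 20 at the point (0,0,0,1) (i.e., lie in the ideal (x,y,z)^{20}) is one-dimensional. -/

import Mathlib

open MvPolynomial Matrix

/-- The golden ratio. -/
noncomputable def gr : ℝ := (1 + Real.sqrt 5) / 2

/-- The first generator of `W(H4)`: `diag(−1,1,1,1)`. -/
def m1 : Matrix (Fin 4) (Fin 4) ℝ :=
  ![![-1, 0, 0, 0], ![0, 1, 0, 0], ![0, 0, 1, 0], ![0, 0, 0, 1]]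

/-- The second generator of `W(H4)`: `diag(1,−1,1,1)`. -/
def m2 : Matrix (Fin 4) (Fin 4) ℝ :=
  ![![1, 0, 0, 0], ![0, -1, 0, 0], ![0, 0, 1, 0], ![0, 0, 0, 1]]

/-- The third generator of `W(H4)`:
`(1/2)·[[φ, φ−1, −1, 0], [φ−1, 1, φ, 0], [−1, φ, 1−φ, 0], [0, 0, 0, 2]]`. -/
noncomputable def m3 : Matrix (Fin 4) (Fin 4) ℝ :=
  (1 / 2 : ℝ) • ![![gr, gr - 1, -1, 0], ![gr - 1, 1, gr, 0],
    ![-1, gr, 1 - gr, 0], ![0, 0, 0, 2]]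

/-- The fourth generator of `W(H4)`. -/
def m4 : Matrix (Fin 4) (Fin 4) ℝ :=
  ![![0, 0, -1, 0], ![0, 0, 0, 1], ![1, 0, 0, 0], ![0, -1, 0, 0]]

/-- The Weyl group `W(H4) ≤ GL₄(ℝ)`, generated by the four matrices above. -/
noncomputable def WH4 : Subgroup (GL (Fin 4) ℝ) :=
  Subgroup.closure { g : GL (Fin 4) ℝ |
    (↑g : Matrix (Fin 4) (Fin 4) ℝ) = m1 ∨ (↑g : Matrix (Fin 4) (Fin 4) ℝ) = m2 ∨
    (↑g : Matrix (Fin 4) (Fin 4) ℝ) = m3 ∨ (↑g : Matrix (Fin 4) (Fin 4) ℝ) = m4 }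

/-- The action of `g ∈ GL₄(ℝ)` on polynomials by linear change of variables:
`(g · F)(v) = F(g⁻¹ v)`. -/
noncomputable def polyActR (g : GL (Fin 4) ℝ) (F : MvPolynomial (Fin 4) ℝ) :
    MvPolynomial (Fin 4) ℝ :=
  aeval (fun i : Fin 4 =>
    ∑ j : Fin 4, ((↑(g⁻¹) : Matrix (Fin 4) (Fin 4) ℝ) i j) • (X j : MvPolynomial (Fin 4) ℝ)) F


namespace H4

abbrev P4 := MvPolynomial (Fin 4) ℝ

theorem gr_sq : gr * gr = gr + 1 := by
  unfold gr
  have h : Real.sqrt 5 * Real.sqrt 5 = 5 := Real.mul_self_sqrt (by norm_num)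
  nlinarith

theorem gr_pos : 0 < gr := by
  unfold gr; positivity

/-- linear form with coefficient vector `u` -/
noncomputable def lin (u : Fin 4 → ℝ) : P4 := ∑ i, C (u i) * X i

/-- linear substitution -/
noncomputable def act (A : Matrix (Fin 4) (Fin 4) ℝ) : P4 →ₐ[ℝ] P4 :=
  aeval (fun i => lin (A i))

theorem eval_lin (u v : Fin 4 → ℝ) : eval v (lin u) = u ⬝ᵥ v := by
  simp [lin, dotProduct]

theorem eval_aeval' {σ : Type*} (g : Fin 4 → MvPolynomial σ ℝ) (F : P4) (v : σ → ℝ) :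
    eval v (aeval g F) = eval (fun i => eval v (g i)) F := by
  induction F using MvPolynomial.induction_on with
  | C a => simp
  | add p q hp hq => rw [map_add, map_add, map_add, hp, hq]
  | mul_X p i hp => rw [map_mul, map_mul, map_mul, hp, aeval_X, eval_X]

theorem eval_act (A : Matrix (Fin 4) (Fin 4) ℝ) (F : P4) (v : Fin 4 → ℝ) :
    eval v (act A F) = eval (A *ᵥ v) F := by
  unfold act
  rw [eval_aeval']
  congr 1
  congr 1
  funext i
  rw [eval_lin]; rfl

theorem act_lin (A : Matrix (Fin 4) (Fin 4) ℝ) (u : Fin 4 → ℝ) :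
    act A (lin u) = lin (Aᵀ *ᵥ u) := by
  apply MvPolynomial.funext
  intro v
  rw [eval_act, eval_lin, eval_lin, Matrix.dotProduct_mulVec, Matrix.mulVec_transpose]

theorem lin_homog (u : Fin 4 → ℝ) : (lin u).IsHomogeneous 1 := by
  unfold lin
  apply MvPolynomial.IsHomogeneous.sum
  intro i _
  exact MvPolynomial.isHomogeneous_C_mul_X _ _

theorem lin_single (i : Fin 4) (c : ℝ) : lin (Pi.single i c) = C c * X i := by
  unfold lin
  rw [Finset.sum_eq_single i]
  · simp
  · intro j _ hj; simp [Pi.single_eq_of_ne hj]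
  · simp

theorem lin_injective {u v : Fin 4 → ℝ} (h : lin u = lin v) : u = v := by
  funext i
  have := congrArg (eval (Pi.single i 1)) h
  simpa [eval_lin] using this

theorem lin_ne_zero {u : Fin 4 → ℝ} (h : u ≠ 0) : lin u ≠ 0 := by
  intro h0
  apply h
  apply lin_injective
  rw [h0]; simp [lin]

theorem lin_smul (c : ℝ) (u : Fin 4 → ℝ) : lin (c • u) = C c * lin u := by
  unfold lin
  rw [Finset.mul_sum]
  apply Finset.sum_congr rfl
  intro i _
  simp [mul_assoc]

theorem lin_neg (u : Fin 4 → ℝ) : lin (-u) = - lin u := by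
  unfold lin
  simp

/-- factor of a nonzero linear form: constant or a multiple -/
theorem dvd_lin {d : P4} {u : Fin 4 → ℝ} (hu : u ≠ 0) (h : d ∣ lin u) :
    IsUnit d ∨ ∃ c : ℝ, c ≠ 0 ∧ d = C c * lin u := by
  obtain ⟨e, he⟩ := h
  have h0 : d * e ≠ 0 := by rw [← he]; exact lin_ne_zero hu
  have hd : d ≠ 0 := left_ne_zero_of_mul h0
  have hee : e ≠ 0 := right_ne_zero_of_mul h0
  have ht := MvPolynomial.totalDegree_mul_of_isDomain hd hee
  rw [← he, (lin_homog u).totalDegree (lin_ne_zero hu)] at ht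
  rcases Nat.eq_zero_or_pos d.totalDegree with h1 | h1
  · left
    rw [MvPolynomial.totalDegree_eq_zero_iff_eq_C] at h1
    have : coeff 0 d ≠ 0 := by
      intro h2; apply hd; rw [h1, h2]; simp
    rw [h1]
    exact (isUnit_iff_ne_zero.mpr this).map C
  · right
    have h2 : e.totalDegree = 0 := by omega
    rw [MvPolynomial.totalDegree_eq_zero_iff_eq_C] at h2
    have h3 : coeff 0 e ≠ 0 := by
      intro h3; apply hee; rw [h2, h3]; simp
    refine ⟨(coeff 0 e)⁻¹, inv_ne_zero h3, ?_⟩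
    rw [he, mul_comm d e]
    conv_rhs => rw [h2]
    rw [← mul_assoc, coeff_C, if_pos rfl, ← C_mul, inv_mul_cancel₀ h3]; simp

theorem lin_relPrime {u v : Fin 4 → ℝ} (i j : Fin 4) (h : u i * v j - u j * v i ≠ 0) :
    IsRelPrime (lin u) (lin v) := by
  have hu : u ≠ 0 := by rintro rfl; simp at h
  have hv : v ≠ 0 := by rintro rfl; simp at h
  intro d h1 h2
  rcases dvd_lin hu h1 with h1 | ⟨c, hc, h1⟩
  · exact h1
  rcases dvd_lin hv h2 with h2 | ⟨c', hc', h2⟩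
  · exact h2
  exfalso
  rw [h1, ← lin_smul, ← lin_smul] at h2
  have h3 := lin_injective h2
  have hi := congrFun h3 i
  have hj := congrFun h3 j
  simp only [Pi.smul_apply, smul_eq_mul] at hi hj
  apply h
  have : c * (u i * v j - u j * v i) = 0 := by linear_combination v j * hi - v i * hj
  rcases mul_eq_zero.mp this with h | h
  · exact absurd h hc
  · exact h

/-! ### substitution `X i ↦ 0` -/

noncomputable def kill (i : Fin 4) : P4 →ₐ[ℝ] P4 :=
  aeval (fun j => if j = i then 0 else X j)

theorem eval_kill (i : Fin 4) (F : P4) (v : Fin 4 → ℝ) :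
    eval v (kill i F) = eval (Function.update v i 0) F := by
  unfold kill
  rw [eval_aeval']
  congr 2
  funext j
  by_cases h : j = i
  · subst h; simp
  · simp [h]

theorem X_dvd_sub_kill (i : Fin 4) (F : P4) : X i ∣ F - kill i F := by
  induction F using MvPolynomial.induction_on with
  | C a => simp [kill]
  | add p q hp hq =>
    have := dvd_add hp hq
    convert this using 1
    simp; ring
  | mul_X p j hp =>
    rw [map_mul]
    by_cases h : j = i
    · subst h
      simp [kill]
    · have : kill i (X j) = X j := by simp [kill, h]
      rw [this, ← sub_mul]
      exact Dvd.dvd.mul_right hp _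

theorem X_dvd_of_kill {i : Fin 4} {F : P4} (h : kill i F = 0) : X i ∣ F := by
  have := X_dvd_sub_kill i F
  rwa [h, sub_zero] at this

theorem X_dvd_of_eval {i : Fin 4} {F : P4} (h : ∀ v, v i = 0 → eval v F = 0) : X i ∣ F := by
  apply X_dvd_of_kill
  apply MvPolynomial.funext
  intro v
  rw [eval_kill, map_zero]
  apply h
  simp

/-- an even polynomial vanishing on `x_i = 0` is divisible by `x_i ^ 2` -/
theorem X_sq_dvd {i : Fin 4} {F : P4} (h : ∀ v, v i = 0 → eval v F = 0)
    (he : ∀ v, eval (Function.update v i (- v i)) F = eval v F) : X i ^ 2 ∣ F := by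
  obtain ⟨q, rfl⟩ := X_dvd_of_eval h
  rw [sq]
  apply mul_dvd_mul_left
  have hq : X i * (aeval (fun j => if j = i then - X i else X j) q + q) = (0 : P4) := by
    apply MvPolynomial.funext
    intro v
    have := he v
    simp only [map_mul, eval_X, Function.update_self, map_add, map_zero] at this ⊢
    rw [eval_aeval']
    have h2 : (fun j => eval v (if j = i then - X i else X j : P4)) =
        Function.update v i (- v i) := by
      funext j
      by_cases h : j = i
      · subst h; simp
      · simp [h]
    rw [h2]
    linear_combination -this
  have hq2 := (mul_eq_zero.mp hq).resolve_left (MvPolynomial.X_ne_zero i)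
  apply X_dvd_of_eval
  intro v hv
  have h3 := congrArg (eval v) hq2
  rw [map_add, eval_aeval'] at h3
  have h2 : (fun j => eval v (if j = i then - X i else X j : P4)) = v := by
    funext j
    by_cases h : j = i
    · subst h; simp [hv]
    · simp [h]
  rw [h2] at h3
  simp at h3
  linarith

theorem eval_smul_homog {F : P4} {n : ℕ} (h : F.IsHomogeneous n) (c : ℝ) (v : Fin 4 → ℝ) :
    eval (fun i => c * v i) F = c ^ n * eval v F := by
  rw [eval_eq, eval_eq, Finset.mul_sum]
  apply Finset.sum_congr rfl
  intro m hm
  have h1 := h (mem_support_iff.mp hm)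
  rw [Finsupp.weight_apply, Finsupp.sum] at h1
  simp only [mul_pow, Finset.prod_mul_distrib]
  rw [Finset.prod_pow_eq_pow_sum]
  simp at h1
  rw [h1]; ring

/-! ### generators -/

noncomputable def gens : Fin 4 → Matrix (Fin 4) (Fin 4) ℝ := ![m1, m2, m3, m4]

theorem gens_orth (k : Fin 4) : (gens k)ᵀ * gens k = 1 := by
  have h := gr_sq
  have e1 : m1ᵀ * m1 = 1 := by
    ext i j
    rw [Matrix.mul_apply, Fin.sum_univ_four]
    simp only [Matrix.transpose_apply]
    fin_cases i <;> fin_cases j <;> simp [m1]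
  have e2 : m2ᵀ * m2 = 1 := by
    ext i j
    rw [Matrix.mul_apply, Fin.sum_univ_four]
    simp only [Matrix.transpose_apply]
    fin_cases i <;> fin_cases j <;> simp [m2]
  have e4 : m4ᵀ * m4 = 1 := by
    ext i j
    rw [Matrix.mul_apply, Fin.sum_univ_four]
    simp only [Matrix.transpose_apply]
    fin_cases i <;> fin_cases j <;> simp [m4]
  have e3 : m3ᵀ * m3 = 1 := by
    ext i j
    rw [Matrix.mul_apply, Fin.sum_univ_four]
    simp only [Matrix.transpose_apply]
    fin_cases i <;> fin_cases j <;> simp [m3] <;> linarith [h]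
  fin_cases k
  · exact e1
  · exact e2
  · exact e3
  · exact e4

theorem gens_orth' (k : Fin 4) : gens k * (gens k)ᵀ = 1 :=
  mul_eq_one_comm.mp (gens_orth k)

def InvG (F : P4) : Prop := ∀ k, ∀ v, eval (gens k *ᵥ v) F = eval v F

theorem InvG.act {F : P4} (h : InvG F) (k : Fin 4) : act (gens k) F = F := by
  apply MvPolynomial.funext
  intro v
  rw [eval_act, h k]

theorem InvG.evalT {F : P4} (h : InvG F) (k : Fin 4) (v : Fin 4 → ℝ) :
    eval ((gens k)ᵀ *ᵥ v) F = eval v F := by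
  rw [← h k, Matrix.mulVec_mulVec, gens_orth', Matrix.one_mulVec]

theorem eval_polyActR (g : GL (Fin 4) ℝ) (F : P4) (v : Fin 4 → ℝ) :
    eval v (polyActR g F) = eval ((↑(g⁻¹) : Matrix (Fin 4) (Fin 4) ℝ) *ᵥ v) F := by
  unfold polyActR
  rw [eval_aeval']
  congr 2
  funext i
  simp [Matrix.mulVec, dotProduct, smul_eval]

theorem invG_of {F : P4} (h : ∀ g ∈ WH4, polyActR g F = F) : InvG F := by
  intro k v
  let g : GL (Fin 4) ℝ := ⟨gens k, (gens k)ᵀ, gens_orth' k, gens_orth k⟩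
  have hg : g ∈ WH4 := by
    apply Subgroup.subset_closure
    simp only [Set.mem_ofPred_eq]
    change gens k = _ ∨ gens k = _ ∨ gens k = _ ∨ gens k = _
    fin_cases k <;> simp [gens]
  have h1 := congrArg (eval (gens k *ᵥ v)) (h g hg)
  rw [eval_polyActR] at h1
  rw [← h1, Matrix.mulVec_mulVec]
  change eval (((gens k)ᵀ * gens k) *ᵥ v) F = _
  rw [gens_orth, Matrix.one_mulVec]

theorem of_invG {F : P4} (h : InvG F) : ∀ g ∈ WH4, polyActR g F = F := by
  have key : ∀ g ∈ WH4, ∀ v, eval ((g : Matrix (Fin 4) (Fin 4) ℝ) *ᵥ v) F = eval v F := by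
    intro g hg
    induction hg using Subgroup.closure_induction with
    | mem g hg =>
      intro v
      rcases hg with hg | hg | hg | hg <;> rw [hg]
      · exact h 0 v
      · exact h 1 v
      · exact h 2 v
      · exact h 3 v
    | one => intro v; simp
    | mul a b _ _ ha hb =>
      intro v
      rw [Units.val_mul, ← Matrix.mulVec_mulVec, ha, hb]
    | inv a _ ha =>
      intro v
      rw [← ha, Matrix.mulVec_mulVec, ← Units.val_mul]
      simp
  intro g hg
  apply MvPolynomial.funext
  intro v
  rw [eval_polyActR]
  exact key _ (inv_mem hg) v

end H4

namespace H4

/-! ### exact arithmetic in `ℤ[φ]` -/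

structure Zp where
  a : Int
  b : Int
  deriving DecidableEq

def zadd (x y : Zp) : Zp := ⟨x.a + y.a, x.b + y.b⟩
def zneg (x : Zp) : Zp := ⟨-x.a, -x.b⟩
def zmul (x y : Zp) : Zp :=
  ⟨x.a * y.a + x.b * y.b, x.a * y.b + x.b * y.a + x.b * y.b⟩
def znz (x : Zp) : Bool := decide (x.a * x.a + x.a * x.b - x.b * x.b ≠ 0)

noncomputable def zr (x : Zp) : ℝ := x.a + x.b * gr

theorem zr_add (x y : Zp) : zr (zadd x y) = zr x + zr y := by
  simp [zr, zadd]; ring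

theorem zr_neg (x : Zp) : zr (zneg x) = - zr x := by
  simp [zr, zneg]; ring

theorem zr_mul (x y : Zp) : zr (zmul x y) = zr x * zr y := by
  simp [zr, zmul]; linear_combination (-(x.b * y.b : ℝ)) * gr_sq

theorem zr_ne {x : Zp} (h : znz x = true) : zr x ≠ 0 := by
  intro h0
  have h1 : ((x.a * x.a + x.a * x.b - x.b * x.b : ℤ) : ℝ) = 0 := by
    have : ((x.a * x.a + x.a * x.b - x.b * x.b : ℤ) : ℝ) = zr x * (x.a + x.b - x.b * gr) := by
      simp only [zr]; push_cast; linear_combination (x.b * x.b : ℝ) * gr_sq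
    rw [this, h0, zero_mul]
  simp only [znz, decide_eq_true_eq] at h
  exact h (by exact_mod_cast h1)

structure V4 where
  x : Zp
  y : Zp
  z : Zp
  w : Zp
  deriving DecidableEq

noncomputable def vr (v : V4) : Fin 4 → ℝ := ![zr v.x, zr v.y, zr v.z, zr v.w]

def vneg (v : V4) : V4 := ⟨zneg v.x, zneg v.y, zneg v.z, zneg v.w⟩

theorem vr_neg (v : V4) : vr (vneg v) = - vr v := by
  funext i
  fin_cases i <;> simp [vr, vneg, zr_neg]

/-- twice the generator -/
def ap2 : Nat → V4 → V4
  | 0, v => ⟨zmul ⟨-2, 0⟩ v.x, zmul ⟨2, 0⟩ v.y, zmul ⟨2, 0⟩ v.z, zmul ⟨2, 0⟩ v.w⟩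
  | 1, v => ⟨zmul ⟨2, 0⟩ v.x, zmul ⟨-2, 0⟩ v.y, zmul ⟨2, 0⟩ v.z, zmul ⟨2, 0⟩ v.w⟩
  | 2, v => ⟨zadd (zmul ⟨0, 1⟩ v.x) (zadd (zmul ⟨-1, 1⟩ v.y) (zneg v.z)),
      zadd (zmul ⟨-1, 1⟩ v.x) (zadd v.y (zmul ⟨0, 1⟩ v.z)),
      zadd (zneg v.x) (zadd (zmul ⟨0, 1⟩ v.y) (zmul ⟨1, -1⟩ v.z)), zmul ⟨2, 0⟩ v.w⟩
  | _, v => ⟨zmul ⟨-2, 0⟩ v.z, zmul ⟨2, 0⟩ v.w, zmul ⟨2, 0⟩ v.x, zmul ⟨-2, 0⟩ v.y⟩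

def dbl (v : V4) : V4 :=
  ⟨zmul ⟨2, 0⟩ v.x, zmul ⟨2, 0⟩ v.y, zmul ⟨2, 0⟩ v.z, zmul ⟨2, 0⟩ v.w⟩

theorem vr_dbl (v : V4) : vr (dbl v) = fun i => 2 * vr v i := by
  funext i
  fin_cases i <;> simp [vr, dbl, zr_mul] <;> simp [zr]

theorem m1_mulVec (v : Fin 4 → ℝ) : m1 *ᵥ v = ![- v 0, v 1, v 2, v 3] := by
  funext i
  simp only [Matrix.mulVec, dotProduct, Fin.sum_univ_four]
  fin_cases i <;> simp [m1]

theorem m2_mulVec (v : Fin 4 → ℝ) : m2 *ᵥ v = ![v 0, - v 1, v 2, v 3] := by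
  funext i
  simp only [Matrix.mulVec, dotProduct, Fin.sum_univ_four]
  fin_cases i <;> simp [m2]

theorem m3_mulVec (v : Fin 4 → ℝ) : m3 *ᵥ v = ![(gr * v 0 + (gr - 1) * v 1 - v 2) / 2,
    ((gr - 1) * v 0 + v 1 + gr * v 2) / 2, (- v 0 + gr * v 1 + (1 - gr) * v 2) / 2, v 3] := by
  funext i
  simp only [Matrix.mulVec, dotProduct, Fin.sum_univ_four]
  fin_cases i <;> simp [m3] <;> ring

theorem m4_mulVec (v : Fin 4 → ℝ) : m4 *ᵥ v = ![- v 2, v 3, v 0, - v 1] := by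
  funext i
  simp only [Matrix.mulVec, dotProduct, Fin.sum_univ_four]
  fin_cases i <;> simp [m4]

theorem vr_ap2 (k : Fin 4) (v : V4) : vr (ap2 k v) = fun i => 2 * (gens k *ᵥ vr v) i := by
  have h0 : vr (ap2 0 v) = fun i => 2 * (m1 *ᵥ vr v) i := by
    rw [m1_mulVec]; funext i
    fin_cases i <;> simp [vr, ap2, zr_mul] <;> simp [zr]
  have h1 : vr (ap2 1 v) = fun i => 2 * (m2 *ᵥ vr v) i := by
    rw [m2_mulVec]; funext i
    fin_cases i <;> simp [vr, ap2, zr_mul] <;> simp [zr]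
  have h2 : vr (ap2 2 v) = fun i => 2 * (m3 *ᵥ vr v) i := by
    rw [m3_mulVec]; funext i
    fin_cases i <;> simp [vr, ap2, zr_mul, zr_add, zr_neg] <;> simp [zr] <;> ring
  have h3 : vr (ap2 3 v) = fun i => 2 * (m4 *ᵥ vr v) i := by
    rw [m4_mulVec]; funext i
    fin_cases i <;> simp [vr, ap2, zr_mul] <;> simp [zr]
  fin_cases k
  · exact h0
  · exact h1
  · exact h2
  · exact h3

structure Step where
  i : Nat
  k : Fin 4
  v : V4

def chk (K : Nat) : List V4 → List Step → Bool
  | _, [] => true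
  | seen, s :: l =>
    (match seen[s.i]? with
    | none => false
    | some u => decide (s.k.val < K) && decide (ap2 s.k u = dbl s.v)) && chk K (seen ++ [s.v]) l

theorem chk_spec (K : Nat) (Q : (Fin 4 → ℝ) → Prop)
    (hQ : ∀ k : Fin 4, k.val < K → ∀ u, Q u → Q (gens k *ᵥ u)) (l : List Step) :
    ∀ seen : List V4, (∀ u ∈ seen, Q (vr u)) → chk K seen l = true →
      ∀ v ∈ seen ++ l.map Step.v, Q (vr v) := by
  induction l with
  | nil => intro seen h _ v hv; simp at hv; exact h v hv
  | cons s l ih =>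
    intro seen h hc v hv
    rw [chk, Bool.and_eq_true] at hc
    obtain ⟨h1, h2⟩ := hc
    have := ih (seen ++ [s.v]) ?_ h2 v (by simpa using hv)
    · exact this
    · intro u hu
      rw [List.mem_append] at hu
      rcases hu with hu | hu
      · exact h u hu
      · simp only [List.mem_singleton] at hu
        subst hu
        split at h1
        · simp at h1
        · rename_i u hu
          simp only [Bool.and_eq_true, decide_eq_true_eq] at h1
          have hm : u ∈ seen := List.mem_of_getElem? hu
          have h3 := hQ s.k h1.1 _ (h u hm)
          have h4 := congrArg vr h1.2
          rw [vr_ap2, vr_dbl] at h4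
          have h5 : gens s.k *ᵥ vr u = vr s.v := by
            funext i
            have := congrFun h4 i
            linarith
          rwa [h5] at h3

def rootSteps : List Step := [⟨0, 3, ⟨⟨0, 0⟩, ⟨2, 0⟩, ⟨0, 0⟩, ⟨0, 0⟩⟩⟩,
  ⟨1, 2, ⟨⟨-1, 1⟩, ⟨1, 0⟩, ⟨0, 1⟩, ⟨0, 0⟩⟩⟩,
  ⟨2, 0, ⟨⟨1, -1⟩, ⟨1, 0⟩, ⟨0, 1⟩, ⟨0, 0⟩⟩⟩,
  ⟨2, 1, ⟨⟨-1, 1⟩, ⟨-1, 0⟩, ⟨0, 1⟩, ⟨0, 0⟩⟩⟩,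
  ⟨2, 3, ⟨⟨0, -1⟩, ⟨0, 0⟩, ⟨-1, 1⟩, ⟨-1, 0⟩⟩⟩,
  ⟨3, 1, ⟨⟨1, -1⟩, ⟨-1, 0⟩, ⟨0, 1⟩, ⟨0, 0⟩⟩⟩,
  ⟨3, 2, ⟨⟨-1, 0⟩, ⟨0, 1⟩, ⟨-1, 1⟩, ⟨0, 0⟩⟩⟩,
  ⟨3, 3, ⟨⟨0, -1⟩, ⟨0, 0⟩, ⟨1, -1⟩, ⟨-1, 0⟩⟩⟩,
  ⟨4, 3, ⟨⟨0, -1⟩, ⟨0, 0⟩, ⟨-1, 1⟩, ⟨1, 0⟩⟩⟩,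
  ⟨5, 0, ⟨⟨0, 1⟩, ⟨0, 0⟩, ⟨-1, 1⟩, ⟨-1, 0⟩⟩⟩,
  ⟨6, 2, ⟨⟨0, -1⟩, ⟨-1, 1⟩, ⟨-1, 0⟩, ⟨0, 0⟩⟩⟩,
  ⟨7, 0, ⟨⟨1, 0⟩, ⟨0, 1⟩, ⟨-1, 1⟩, ⟨0, 0⟩⟩⟩,
  ⟨7, 1, ⟨⟨-1, 0⟩, ⟨0, -1⟩, ⟨-1, 1⟩, ⟨0, 0⟩⟩⟩,
  ⟨7, 3, ⟨⟨1, -1⟩, ⟨0, 0⟩, ⟨-1, 0⟩, ⟨0, -1⟩⟩⟩,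
  ⟨8, 2, ⟨⟨-1, 0⟩, ⟨-1, 0⟩, ⟨1, 0⟩, ⟨-1, 0⟩⟩⟩,
  ⟨10, 2, ⟨⟨1, 0⟩, ⟨1, 0⟩, ⟨-1, 0⟩, ⟨-1, 0⟩⟩⟩,
  ⟨11, 0, ⟨⟨0, 1⟩, ⟨-1, 1⟩, ⟨-1, 0⟩, ⟨0, 0⟩⟩⟩,
  ⟨11, 1, ⟨⟨0, -1⟩, ⟨1, -1⟩, ⟨-1, 0⟩, ⟨0, 0⟩⟩⟩,
  ⟨11, 3, ⟨⟨1, 0⟩, ⟨0, 0⟩, ⟨0, -1⟩, ⟨1, -1⟩⟩⟩,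
  ⟨12, 1, ⟨⟨1, 0⟩, ⟨0, -1⟩, ⟨-1, 1⟩, ⟨0, 0⟩⟩⟩,
  ⟨12, 3, ⟨⟨1, -1⟩, ⟨0, 0⟩, ⟨1, 0⟩, ⟨0, -1⟩⟩⟩,
  ⟨13, 3, ⟨⟨1, -1⟩, ⟨0, 0⟩, ⟨-1, 0⟩, ⟨0, 1⟩⟩⟩,
  ⟨14, 0, ⟨⟨-1, 1⟩, ⟨0, 0⟩, ⟨-1, 0⟩, ⟨0, -1⟩⟩⟩,
  ⟨14, 2, ⟨⟨0, 0⟩, ⟨-1, 0⟩, ⟨-1, 1⟩, ⟨0, -1⟩⟩⟩,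
  ⟨15, 0, ⟨⟨1, 0⟩, ⟨-1, 0⟩, ⟨1, 0⟩, ⟨-1, 0⟩⟩⟩,
  ⟨15, 1, ⟨⟨-1, 0⟩, ⟨1, 0⟩, ⟨1, 0⟩, ⟨-1, 0⟩⟩⟩,
  ⟨15, 3, ⟨⟨-1, 0⟩, ⟨-1, 0⟩, ⟨-1, 0⟩, ⟨1, 0⟩⟩⟩,
  ⟨16, 0, ⟨⟨-1, 0⟩, ⟨1, 0⟩, ⟨-1, 0⟩, ⟨-1, 0⟩⟩⟩,
  ⟨16, 1, ⟨⟨1, 0⟩, ⟨-1, 0⟩, ⟨-1, 0⟩, ⟨-1, 0⟩⟩⟩,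
  ⟨17, 1, ⟨⟨0, 1⟩, ⟨1, -1⟩, ⟨-1, 0⟩, ⟨0, 0⟩⟩⟩,
  ⟨17, 2, ⟨⟨2, 0⟩, ⟨0, 0⟩, ⟨0, 0⟩, ⟨0, 0⟩⟩⟩,
  ⟨17, 3, ⟨⟨1, 0⟩, ⟨0, 0⟩, ⟨0, 1⟩, ⟨1, -1⟩⟩⟩,
  ⟨18, 3, ⟨⟨1, 0⟩, ⟨0, 0⟩, ⟨0, -1⟩, ⟨-1, 1⟩⟩⟩,
  ⟨19, 0, ⟨⟨-1, 0⟩, ⟨0, 0⟩, ⟨0, -1⟩, ⟨1, -1⟩⟩⟩,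
  ⟨19, 2, ⟨⟨0, 1⟩, ⟨-1, 0⟩, ⟨0, 0⟩, ⟨1, -1⟩⟩⟩,
  ⟨20, 2, ⟨⟨0, 0⟩, ⟨0, 0⟩, ⟨-2, 0⟩, ⟨0, 0⟩⟩⟩,
  ⟨21, 2, ⟨⟨-1, 0⟩, ⟨-1, 1⟩, ⟨0, 0⟩, ⟨0, -1⟩⟩⟩,
  ⟨22, 2, ⟨⟨0, 0⟩, ⟨-1, 0⟩, ⟨-1, 1⟩, ⟨0, 1⟩⟩⟩,
  ⟨23, 2, ⟨⟨1, 0⟩, ⟨1, -1⟩, ⟨0, 0⟩, ⟨0, -1⟩⟩⟩,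
  ⟨24, 1, ⟨⟨0, 0⟩, ⟨1, 0⟩, ⟨-1, 1⟩, ⟨0, -1⟩⟩⟩,
  ⟨24, 3, ⟨⟨1, -1⟩, ⟨0, -1⟩, ⟨0, 0⟩, ⟨1, 0⟩⟩⟩,
  ⟨25, 2, ⟨⟨0, 0⟩, ⟨-1, 1⟩, ⟨0, -1⟩, ⟨-1, 0⟩⟩⟩,
  ⟨26, 3, ⟨⟨-1, 0⟩, ⟨-1, 0⟩, ⟨-1, 0⟩, ⟨-1, 0⟩⟩⟩,
  ⟨28, 2, ⟨⟨0, 0⟩, ⟨1, -1⟩, ⟨0, 1⟩, ⟨-1, 0⟩⟩⟩,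
  ⟨32, 2, ⟨⟨0, 0⟩, ⟨0, 1⟩, ⟨-1, 0⟩, ⟨1, -1⟩⟩⟩,
  ⟨33, 2, ⟨⟨0, 1⟩, ⟨-1, 0⟩, ⟨0, 0⟩, ⟨-1, 1⟩⟩⟩,
  ⟨34, 2, ⟨⟨0, 0⟩, ⟨0, -1⟩, ⟨1, 0⟩, ⟨1, -1⟩⟩⟩,
  ⟨35, 0, ⟨⟨0, -1⟩, ⟨-1, 0⟩, ⟨0, 0⟩, ⟨1, -1⟩⟩⟩,
  ⟨35, 1, ⟨⟨0, 1⟩, ⟨1, 0⟩, ⟨0, 0⟩, ⟨1, -1⟩⟩⟩,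
  ⟨37, 0, ⟨⟨1, 0⟩, ⟨-1, 1⟩, ⟨0, 0⟩, ⟨0, -1⟩⟩⟩,
  ⟨37, 1, ⟨⟨-1, 0⟩, ⟨1, -1⟩, ⟨0, 0⟩, ⟨0, -1⟩⟩⟩,
  ⟨37, 3, ⟨⟨0, 0⟩, ⟨0, -1⟩, ⟨-1, 0⟩, ⟨1, -1⟩⟩⟩,
  ⟨38, 1, ⟨⟨0, 0⟩, ⟨1, 0⟩, ⟨-1, 1⟩, ⟨0, 1⟩⟩⟩,
  ⟨38, 3, ⟨⟨1, -1⟩, ⟨0, 1⟩, ⟨0, 0⟩, ⟨1, 0⟩⟩⟩,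
  ⟨40, 3, ⟨⟨1, -1⟩, ⟨0, -1⟩, ⟨0, 0⟩, ⟨-1, 0⟩⟩⟩,
  ⟨41, 0, ⟨⟨-1, 1⟩, ⟨0, -1⟩, ⟨0, 0⟩, ⟨1, 0⟩⟩⟩,
  ⟨42, 1, ⟨⟨0, 0⟩, ⟨1, -1⟩, ⟨0, -1⟩, ⟨-1, 0⟩⟩⟩,
  ⟨44, 1, ⟨⟨0, 0⟩, ⟨-1, 1⟩, ⟨0, 1⟩, ⟨-1, 0⟩⟩⟩,
  ⟨47, 1, ⟨⟨0, 0⟩, ⟨0, 1⟩, ⟨1, 0⟩, ⟨1, -1⟩⟩⟩]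

def hrootSteps : List Step := [⟨0, 2, ⟨⟨-1, 1⟩, ⟨1, 0⟩, ⟨0, 1⟩, ⟨0, 0⟩⟩⟩,
  ⟨1, 0, ⟨⟨1, -1⟩, ⟨1, 0⟩, ⟨0, 1⟩, ⟨0, 0⟩⟩⟩,
  ⟨1, 1, ⟨⟨-1, 1⟩, ⟨-1, 0⟩, ⟨0, 1⟩, ⟨0, 0⟩⟩⟩,
  ⟨2, 1, ⟨⟨1, -1⟩, ⟨-1, 0⟩, ⟨0, 1⟩, ⟨0, 0⟩⟩⟩,
  ⟨2, 2, ⟨⟨-1, 0⟩, ⟨0, 1⟩, ⟨-1, 1⟩, ⟨0, 0⟩⟩⟩,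
  ⟨4, 2, ⟨⟨0, -1⟩, ⟨-1, 1⟩, ⟨-1, 0⟩, ⟨0, 0⟩⟩⟩,
  ⟨5, 0, ⟨⟨1, 0⟩, ⟨0, 1⟩, ⟨-1, 1⟩, ⟨0, 0⟩⟩⟩,
  ⟨5, 1, ⟨⟨-1, 0⟩, ⟨0, -1⟩, ⟨-1, 1⟩, ⟨0, 0⟩⟩⟩,
  ⟨6, 0, ⟨⟨0, 1⟩, ⟨-1, 1⟩, ⟨-1, 0⟩, ⟨0, 0⟩⟩⟩,
  ⟨6, 1, ⟨⟨0, -1⟩, ⟨1, -1⟩, ⟨-1, 0⟩, ⟨0, 0⟩⟩⟩,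
  ⟨7, 1, ⟨⟨1, 0⟩, ⟨0, -1⟩, ⟨-1, 1⟩, ⟨0, 0⟩⟩⟩,
  ⟨9, 1, ⟨⟨0, 1⟩, ⟨1, -1⟩, ⟨-1, 0⟩, ⟨0, 0⟩⟩⟩,
  ⟨9, 2, ⟨⟨2, 0⟩, ⟨0, 0⟩, ⟨0, 0⟩, ⟨0, 0⟩⟩⟩,
  ⟨11, 2, ⟨⟨0, 0⟩, ⟨0, 0⟩, ⟨-2, 0⟩, ⟨0, 0⟩⟩⟩]

def axisSteps : List Step := [⟨0, 0, ⟨⟨0, -1⟩, ⟨1, 0⟩, ⟨0, 0⟩, ⟨0, 0⟩⟩⟩,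
  ⟨1, 2, ⟨⟨-1, 0⟩, ⟨0, 0⟩, ⟨0, 1⟩, ⟨0, 0⟩⟩⟩,
  ⟨2, 0, ⟨⟨1, 0⟩, ⟨0, 0⟩, ⟨0, 1⟩, ⟨0, 0⟩⟩⟩,
  ⟨3, 2, ⟨⟨0, 0⟩, ⟨0, 1⟩, ⟨-1, 0⟩, ⟨0, 0⟩⟩⟩,
  ⟨4, 1, ⟨⟨0, 0⟩, ⟨0, -1⟩, ⟨-1, 0⟩, ⟨0, 0⟩⟩⟩]

def roots : List V4 := [⟨⟨0, 0⟩, ⟨0, 0⟩, ⟨0, 0⟩, ⟨2, 0⟩⟩] ++ rootSteps.map Step.v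
def hroots : List V4 := [⟨⟨0, 0⟩, ⟨2, 0⟩, ⟨0, 0⟩, ⟨0, 0⟩⟩] ++ hrootSteps.map Step.v
def axes : List V4 := [⟨⟨0, 1⟩, ⟨1, 0⟩, ⟨0, 0⟩, ⟨0, 0⟩⟩] ++ axisSteps.map Step.v

theorem roots_closure (Q : (Fin 4 → ℝ) → Prop) (hQ : ∀ k : Fin 4, ∀ u, Q u → Q (gens k *ᵥ u))
    (h0 : Q (vr ⟨⟨0, 0⟩, ⟨0, 0⟩, ⟨0, 0⟩, ⟨2, 0⟩⟩)) : ∀ v ∈ roots, Q (vr v) :=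
  chk_spec 4 Q (fun k _ => hQ k) rootSteps _ (by simpa using h0) (by decide +kernel)

theorem hroots_closure (Q : (Fin 4 → ℝ) → Prop)
    (hQ : ∀ k : Fin 4, k.val < 3 → ∀ u, Q u → Q (gens k *ᵥ u))
    (h0 : Q (vr ⟨⟨0, 0⟩, ⟨2, 0⟩, ⟨0, 0⟩, ⟨0, 0⟩⟩)) : ∀ v ∈ hroots, Q (vr v) :=
  chk_spec 3 Q hQ hrootSteps _ (by simpa using h0) (by decide +kernel)

theorem axes_closure (Q : (Fin 4 → ℝ) → Prop)
    (hQ : ∀ k : Fin 4, k.val < 3 → ∀ u, Q u → Q (gens k *ᵥ u))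
    (h0 : Q (vr ⟨⟨0, 1⟩, ⟨1, 0⟩, ⟨0, 0⟩, ⟨0, 0⟩⟩)) : ∀ v ∈ axes, Q (vr v) :=
  chk_spec 3 Q hQ axisSteps _ (by simpa using h0) (by decide +kernel)

/-! ### products of pairwise non-proportional linear forms -/

def minor (a b c d : Zp) : Bool := znz (zadd (zmul a d) (zneg (zmul b c)))

def np (u v : V4) : Bool :=
  minor u.x u.y v.x v.y || minor u.x u.z v.x v.z || minor u.x u.w v.x v.w ||
  minor u.y u.z v.y v.z || minor u.y u.w v.y v.w || minor u.z u.w v.z v.w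

theorem minor_spec {a b c d : Zp} (h : minor a b c d = true) :
    zr a * zr d - zr b * zr c ≠ 0 := by
  have := zr_ne h
  rw [zr_add, zr_neg, zr_mul, zr_mul] at this
  intro h0; apply this; linarith

theorem np_spec {u v : V4} (h : np u v = true) : IsRelPrime (lin (vr u)) (lin (vr v)) := by
  simp only [np, Bool.or_eq_true] at h
  rcases h with ((((h | h) | h) | h) | h) | h
  · exact lin_relPrime 0 1 (minor_spec h)
  · exact lin_relPrime 0 2 (minor_spec h)
  · exact lin_relPrime 0 3 (minor_spec h)
  · exact lin_relPrime 1 2 (minor_spec h)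
  · exact lin_relPrime 1 3 (minor_spec h)
  · exact lin_relPrime 2 3 (minor_spec h)

def pwnp : List (V4 × Nat) → Bool
  | [] => true
  | a :: l => l.all (fun b => np a.1 b.1) && pwnp l

noncomputable def lprod (l : List (V4 × Nat)) : P4 := (l.map (fun a => lin (vr a.1) ^ a.2)).prod

theorem lprod_cons (a : V4 × Nat) (l) : lprod (a :: l) = lin (vr a.1) ^ a.2 * lprod l := rfl

theorem relPrime_lprod (p : P4) (l : List (V4 × Nat))
    (h : ∀ b ∈ l, IsRelPrime p (lin (vr b.1))) (n : ℕ) : IsRelPrime (p ^ n) (lprod l) := by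
  induction l with
  | nil => exact isRelPrime_one_right
  | cons a l ih =>
    rw [lprod_cons]
    apply IsRelPrime.mul_right
    · exact (h a (by simp)).pow
    · exact ih (fun b hb => h b (by simp [hb]))

theorem lprod_dvd (F : P4) (l : List (V4 × Nat)) (hl : pwnp l = true)
    (h : ∀ a ∈ l, lin (vr a.1) ^ a.2 ∣ F) : lprod l ∣ F := by
  induction l with
  | nil => exact one_dvd _
  | cons a l ih =>
    rw [pwnp, Bool.and_eq_true, List.all_eq_true] at hl
    rw [lprod_cons]
    apply IsRelPrime.mul_dvd
    · exact relPrime_lprod _ _ (fun b hb => np_spec (hl.1 b hb)) _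
    · exact h a (by simp)
    · exact ih hl.2 (fun b hb => h b (by simp [hb]))

theorem lprod_homog (l : List (V4 × Nat)) : (lprod l).IsHomogeneous (l.map Prod.snd).sum := by
  induction l with
  | nil => exact MvPolynomial.isHomogeneous_one _ _
  | cons a l ih =>
    rw [lprod_cons, List.map_cons, List.sum_cons]
    refine MvPolynomial.IsHomogeneous.mul ?_ ih
    simpa using (lin_homog (vr a.1)).pow a.2

theorem eq_zero_of_dvd {F p : P4} {n m : ℕ} (hF : F.IsHomogeneous n) (hp : p.IsHomogeneous m)
    (h : p ∣ F) (hnm : n < m) : F = 0 := by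
  by_contra h0
  obtain ⟨q, rfl⟩ := h
  have h1 := MvPolynomial.totalDegree_mul_of_isDomain (left_ne_zero_of_mul h0)
    (right_ne_zero_of_mul h0)
  rw [hF.totalDegree h0, hp.totalDegree (left_ne_zero_of_mul h0)] at h1
  omega

theorem eq_C_of_dvd {F p : P4} {n : ℕ} (hF : F.IsHomogeneous n) (hp : p.IsHomogeneous n)
    (h : p ∣ F) : ∃ c : ℝ, F = C c * p := by
  by_cases h0 : F = 0
  · exact ⟨0, by simp [h0]⟩
  obtain ⟨q, rfl⟩ := h
  have h1 := MvPolynomial.totalDegree_mul_of_isDomain (left_ne_zero_of_mul h0)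
    (right_ne_zero_of_mul h0)
  rw [hF.totalDegree h0, hp.totalDegree (left_ne_zero_of_mul h0)] at h1
  have h2 : q.totalDegree = 0 := by omega
  rw [MvPolynomial.totalDegree_eq_zero_iff_eq_C] at h2
  exact ⟨coeff 0 q, by rw [← h2]; ring⟩

/-- transport of divisibility -/
theorem dvd_step {F : P4} {k : Fin 4} (h : act (gens k)ᵀ F = F) (e : ℕ) (u : Fin 4 → ℝ)
    (hu : lin u ^ e ∣ F) : lin (gens k *ᵥ u) ^ e ∣ F := by
  have := map_dvd (act (gens k)ᵀ) hu
  rwa [h, map_pow, act_lin, Matrix.transpose_transpose] at this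

theorem act_of_eval {F : P4} {k : Fin 4} (h : ∀ v, eval (gens k *ᵥ v) F = eval v F) :
    act (gens k)ᵀ F = F := by
  apply MvPolynomial.funext
  intro v
  rw [eval_act, ← h, Matrix.mulVec_mulVec, gens_orth', Matrix.one_mulVec]

theorem hroots_pw : pwnp (hroots.map (fun v => (v, 2)) ++ axes.map (fun v => (v, 7))) = true := by
  decide +kernel
theorem hroots_pw' : pwnp (hroots.map (fun v => (v, 2))) = true := by
  decide +kernel
theorem roots_pw : pwnp (roots.map (fun v => (v, 2))) = true := by
  decide +kernel

/-- invariance under the parabolic subgroup `H3` fixing `w` -/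
def InvH (F : P4) : Prop := ∀ k : Fin 4, k.val < 3 → ∀ v, eval (gens k *ᵥ v) F = eval v F

theorem hroots_dvd {F : P4} (hF : InvH F) (h0 : X 1 ^ 2 ∣ F) :
    ∀ v ∈ hroots, lin (vr v) ^ 2 ∣ F := by
  apply hroots_closure (fun u => lin u ^ 2 ∣ F)
  · intro k hk u hu
    exact dvd_step (act_of_eval (hF k hk)) 2 u hu
  · have : vr ⟨⟨0, 0⟩, ⟨2, 0⟩, ⟨0, 0⟩, ⟨0, 0⟩⟩ = Pi.single 1 2 := by
      funext i; fin_cases i <;> simp [vr, zr]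
    rw [this, lin_single, mul_pow]
    rw [← map_pow]
    exact (IsUnit.mul_left_dvd (IsUnit.map C (isUnit_iff_ne_zero.mpr (by norm_num)))).mpr h0

theorem axes_dvd {F : P4} (hF : InvH F) (h0 : lin ![gr, 1, 0, 0] ^ 7 ∣ F) :
    ∀ v ∈ axes, lin (vr v) ^ 7 ∣ F := by
  apply axes_closure (fun u => lin u ^ 7 ∣ F)
  · intro k hk u hu
    exact dvd_step (act_of_eval (hF k hk)) 7 u hu
  · have : vr ⟨⟨0, 1⟩, ⟨1, 0⟩, ⟨0, 0⟩, ⟨0, 0⟩⟩ = ![gr, 1, 0, 0] := by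
      funext i; fin_cases i <;> simp [vr, zr]
    rwa [this]

theorem roots_dvd {F : P4} (hF : InvG F) (h0 : X 3 ^ 2 ∣ F) :
    ∀ v ∈ roots, lin (vr v) ^ 2 ∣ F := by
  apply roots_closure (fun u => lin u ^ 2 ∣ F)
  · intro k u hu
    exact dvd_step (act_of_eval (hF k)) 2 u hu
  · have : vr ⟨⟨0, 0⟩, ⟨0, 0⟩, ⟨0, 0⟩, ⟨2, 0⟩⟩ = Pi.single 3 2 := by
      funext i; fin_cases i <;> simp [vr, zr]
    rw [this, lin_single, mul_pow]
    rw [← map_pow]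
    exact (IsUnit.mul_left_dvd (IsUnit.map C (isUnit_iff_ne_zero.mpr (by norm_num)))).mpr h0

/-- a polynomial of degree `< 30`, `H3`-invariant and vanishing on `y = 0`, is zero -/
theorem zero_of_H3 {F : P4} {n : ℕ} (hF : InvH F) (hn : F.IsHomogeneous n) (h30 : n < 30)
    (h0 : X 1 ^ 2 ∣ F) : F = 0 := by
  have h1 := hroots_dvd hF h0
  have h2 := lprod_dvd F _ hroots_pw' (by
    intro a ha
    rw [List.mem_map] at ha
    obtain ⟨v, hv, rfl⟩ := ha
    exact h1 v hv)
  refine eq_zero_of_dvd hn (lprod_homog _) h2 ?_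
  have : (List.map Prod.snd (hroots.map (fun v => (v, 2)))).sum = 30 := by decide +kernel
  omega

theorem zero_of_H4 {F : P4} (hF : InvG F) (hn : F.IsHomogeneous 72)
    (h0 : X 3 ^ 2 ∣ F) : F = 0 := by
  have h1 := roots_dvd hF h0
  have h2 := lprod_dvd F _ roots_pw (by
    intro a ha
    rw [List.mem_map] at ha
    obtain ⟨v, hv, rfl⟩ := ha
    exact h1 v hv)
  refine eq_zero_of_dvd hn (lprod_homog _) h2 ?_
  have : (List.map Prod.snd (roots.map (fun v => (v, 2)))).sum = 120 := by decide +kernel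
  omega

end H4

namespace H4

/-! ### multiplicity ideals -/

noncomputable def Iperp (r : Fin 4 → ℝ) : Ideal P4 := Ideal.span {p | ∃ u : Fin 4 → ℝ, u ⬝ᵥ r = 0 ∧ p = lin u}

theorem mem_map_pow {S : Type*} [CommRing S] [Algebra ℝ S] (f : P4 →ₐ[ℝ] S) {r : Fin 4 → ℝ}
    {J : Ideal S} {n : ℕ} {F : P4} (hF : F ∈ Iperp r ^ n)
    (h : ∀ u : Fin 4 → ℝ, u ⬝ᵥ r = 0 → f (lin u) ∈ J) : f F ∈ J ^ n := by
  have h1 : (Iperp r).map f ≤ J := by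
    rw [Iperp, Ideal.map_span, Ideal.span_le]
    rintro _ ⟨_, ⟨u, hu, rfl⟩, rfl⟩
    exact h u hu
  have h2 := Ideal.mem_map_of_mem f hF
  rw [Ideal.map_pow] at h2
  exact Ideal.pow_right_mono h1 n h2

theorem mult_step {F : P4} {k : Fin 4} (h : act (gens k)ᵀ F = F) (n : ℕ) (r : Fin 4 → ℝ)
    (hr : F ∈ Iperp r ^ n) : F ∈ Iperp (gens k *ᵥ r) ^ n := by
  rw [← h]
  apply mem_map_pow _ hr
  intro u hu
  rw [act_lin, Matrix.transpose_transpose]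
  apply Ideal.subset_span
  refine ⟨_, ?_, rfl⟩
  rw [Matrix.dotProduct_mulVec, Matrix.vecMul_mulVec, gens_orth, Matrix.vecMul_one]
  exact hu

theorem mult_start {F : P4} (h : F ∈ (Ideal.span {X 0, X 1, X 2} : Ideal P4) ^ 20) :
    F ∈ Iperp (vr ⟨⟨0, 0⟩, ⟨0, 0⟩, ⟨0, 0⟩, ⟨2, 0⟩⟩) ^ 20 := by
  refine Ideal.pow_right_mono ?_ 20 h
  rw [Ideal.span_le]
  have key : ∀ i : Fin 4, i ≠ 3 → (X i : P4) ∈ Iperp (vr ⟨⟨0, 0⟩, ⟨0, 0⟩, ⟨0, 0⟩, ⟨2, 0⟩⟩) := by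
    intro i hi
    apply Ideal.subset_span
    refine ⟨Pi.single i 1, ?_, ?_⟩
    · rw [single_dotProduct]
      fin_cases i <;> simp [vr, zr] at hi ⊢
    · rw [lin_single]; simp
  rintro p (rfl | rfl | rfl)
  · exact key 0 (by decide)
  · exact key 1 (by decide)
  · exact key 2 (by decide)

theorem mult_roots {F : P4} (hF : InvG F)
    (h : F ∈ (Ideal.span {X 0, X 1, X 2} : Ideal P4) ^ 20) :
    ∀ v ∈ roots, F ∈ Iperp (vr v) ^ 20 :=
  roots_closure (fun r => F ∈ Iperp r ^ 20)
    (fun k u hu => mult_step (act_of_eval (hF k)) 20 u hu) (mult_start h)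

/-! ### dehomogenisation -/

open Polynomial in
theorem coeff_dvd_of_mem {R : Type*} [CommRing R] (a : R) (n : ℕ) : ∀ (G : R[X]),
    G ∈ (Ideal.span {Polynomial.C a, (Polynomial.X : R[X])}) ^ n → ∀ k, a ^ (n - k) ∣ G.coeff k := by
  induction n with
  | zero => intro G _ k; simp
  | succ n ih =>
    intro G hG
    rw [pow_succ] at hG
    induction hG using Submodule.mul_induction_on' with
    | mem_mul_mem p hp q hq =>
      intro k
      obtain ⟨x, y, rfl⟩ := Ideal.mem_span_pair.mp hq
      have h1 := ih _ (Ideal.mul_mem_right x _ hp) 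
      have h2 := ih _ (Ideal.mul_mem_right y _ hp)
      have e : p * (x * Polynomial.C a + y * Polynomial.X) =
        (p * x) * Polynomial.C a + (p * y) * Polynomial.X := by ring
      rw [e, Polynomial.coeff_add, Polynomial.coeff_mul_C]
      apply dvd_add
      · refine dvd_trans (pow_dvd_pow a (show n + 1 - k ≤ (n - k) + 1 by omega)) ?_
        rw [pow_succ]
        exact mul_dvd_mul_right (h1 k) a
      · cases k with
        | zero => simp
        | succ k =>
          rw [Polynomial.coeff_mul_X]
          have : n + 1 - (k + 1) = n - k := by omega
          rw [this]; exact h2 k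
    | add p _ q _ hp hq =>
      intro k
      rw [Polynomial.coeff_add]
      exact dvd_add (hp k) (hq k)

noncomputable def Om : P4 →ₐ[ℝ] Polynomial (Polynomial ℝ) :=
  aeval ![Polynomial.C Polynomial.X, Polynomial.X, 1, 0]

theorem Om_monomial (m : Fin 4 →₀ ℕ) (c : ℝ) (a b : ℕ) :
    ((Om (monomial m c)).coeff b).coeff a = if m 0 = a ∧ m 1 = b ∧ m 3 = 0 then c else 0 := by
  unfold Om
  rw [aeval_monomial, Finsupp.prod_fintype _ _ (by simp), Fin.prod_univ_four]
  simp only [Matrix.cons_val, one_pow, mul_one]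
  rw [IsScalarTower.algebraMap_apply ℝ (Polynomial ℝ) (Polynomial (Polynomial ℝ)),
    Polynomial.algebraMap_eq, Polynomial.algebraMap_eq]
  rw [← Polynomial.C_pow]
  by_cases h3 : m 3 = 0
  · rw [h3, pow_zero, mul_one, ← mul_assoc, ← Polynomial.C_mul, Polynomial.coeff_C_mul,
      Polynomial.coeff_X_pow]
    by_cases hb : b = m 1
    · subst hb
      simp [Polynomial.coeff_X_pow, eq_comm]
    · simp [hb, Ne.symm hb]
  · simp [h3]

theorem Om_coeff (F : P4) (a b : ℕ) : ((Om F).coeff b).coeff a =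
    ∑ m ∈ F.support, if m 0 = a ∧ m 1 = b ∧ m 3 = 0 then coeff m F else 0 := by
  conv_lhs => rw [F.as_sum]
  rw [map_sum, Polynomial.finsetSum_coeff, Polynomial.finsetSum_coeff]
  exact Finset.sum_congr rfl (fun m _ => Om_monomial m _ a b)

theorem homog_sum {F : P4} {n : ℕ} (hF : F.IsHomogeneous n) {m : Fin 4 →₀ ℕ} (hm : m ∈ F.support) :
    m 0 + m 1 + m 2 + m 3 = n := by
  have h1 := hF (mem_support_iff.mp hm)
  rw [Finsupp.weight_apply, Finsupp.sum_fintype _ _ (by simp), Fin.sum_univ_four] at h1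
  simpa using h1

theorem Om_deg {F : P4} {n : ℕ} (hF : F.IsHomogeneous n) (k : ℕ) :
    ((Om F).coeff k).natDegree ≤ n - k := by
  rw [Polynomial.natDegree_le_iff_coeff_eq_zero]
  intro N hN
  rw [Om_coeff]
  apply Finset.sum_eq_zero
  intro m hm
  have := homog_sum hF hm
  rw [if_neg]
  rintro ⟨h1, h2, h3⟩
  omega

theorem X_pow_dvd_kill {F : P4} {n e : ℕ} (hF : F.IsHomogeneous n)
    (h : ∀ k < e, (Om F).coeff k = 0) : X 1 ^ e ∣ kill 3 F := by
  have key : ∀ m ∈ F.support, X 1 ^ e ∣ kill 3 (monomial m (coeff m F)) := by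
    intro m hm
    by_cases h3 : m 3 = 0
    · have h1 : e ≤ m 1 := by
        by_contra hlt
        have h4 := congrArg (fun p => Polynomial.coeff p (m 0)) (h (m 1) (by omega))
        simp only [Polynomial.coeff_zero] at h4
        rw [Om_coeff, Finset.sum_eq_single m] at h4
        · rw [if_pos ⟨rfl, rfl, h3⟩] at h4
          exact mem_support_iff.mp hm h4
        · intro m' hm' hne
          rw [if_neg]
          rintro ⟨g0, g1, g3⟩
          apply hne
          have := homog_sum hF hm
          have := homog_sum hF hm'
          ext i
          fin_cases i
          · exact g0
          · exact g1
          · change m' 2 = m 2; omega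
          · change m' 3 = m 3; omega
        · intro h; exact absurd hm h
      rw [kill, aeval_monomial, Finsupp.prod_fintype _ _ (by simp), Fin.prod_univ_four]
      apply Dvd.dvd.mul_left
      apply Dvd.dvd.mul_right
      apply Dvd.dvd.mul_right
      apply Dvd.dvd.mul_left
      simpa using pow_dvd_pow _ h1
    · rw [kill, aeval_monomial, Finsupp.prod_fintype _ _ (by simp), Fin.prod_univ_four]
      simp [h3]
  conv_rhs => rw [F.as_sum]
  rw [map_sum]
  exact Finset.dvd_sum key

/-- shear `y ↦ y - φ x` -/
noncomputable def shear (c : ℝ) : Matrix (Fin 4) (Fin 4) ℝ :=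
  !![1, 0, 0, 0; -c, 1, 0, 0; 0, 0, 1, 0; 0, 0, 0, 1]

theorem shear_mulVec (c : ℝ) (v : Fin 4 → ℝ) :
    shear c *ᵥ v = ![v 0, v 1 - c * v 0, v 2, v 3] := by
  funext i
  simp only [Matrix.mulVec, dotProduct, Fin.sum_univ_four]
  fin_cases i <;> simp [shear] <;> ring

theorem act_homog (A : Matrix (Fin 4) (Fin 4) ℝ) {F : P4} {n : ℕ} (hF : F.IsHomogeneous n) :
    (act A F).IsHomogeneous n := by
  have := hF.aeval (fun i => lin (A i)) (fun i => lin_homog (A i))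
  simpa [act] using this

theorem Om_shear_lin (u : Fin 4 → ℝ) : Om (act (shear gr) (lin u)) =
    Polynomial.C (Polynomial.C (u 1)) * Polynomial.X +
    Polynomial.C (Polynomial.C (u 0 - gr * u 1) * Polynomial.X + Polynomial.C (u 2)) := by
  rw [act_lin]
  have : (shear gr)ᵀ *ᵥ u = ![u 0 - gr * u 1, u 1, u 2, u 3] := by
    funext i
    simp only [Matrix.mulVec, dotProduct, Fin.sum_univ_four]
    fin_cases i <;> simp [shear] <;> ring
  rw [this, lin, Fin.sum_univ_four]
  simp only [map_add, map_mul, Om, aeval_X, aeval_C, Matrix.cons_val]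
  simp only [IsScalarTower.algebraMap_apply ℝ (Polynomial ℝ) (Polynomial (Polynomial ℝ)),
    Polynomial.algebraMap_eq]
  ring

theorem Om_coeff_dvd {F : P4} {r : Fin 4 → ℝ} (hF : F ∈ Iperp r ^ 20) (c t0 : ℝ) (hc : c ≠ 0)
    (hr : r = ![c * t0, - (gr * (c * t0)), c, 0]) (k : ℕ) :
    (Polynomial.X - Polynomial.C t0) ^ (20 - k) ∣ (Om (act (shear gr) F)).coeff k := by
  apply coeff_dvd_of_mem
  refine mem_map_pow (Om.comp (act (shear gr))) hF ?_
  intro u hu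
  rw [AlgHom.comp_apply, Om_shear_lin]
  have h2 : u 2 = - (t0 * (u 0 - gr * u 1)) := by
    rw [hr] at hu
    simp [dotProduct, Fin.sum_univ_four] at hu
    have : c * (u 2 + t0 * (u 0 - gr * u 1)) = 0 := by linarith
    rcases mul_eq_zero.mp this with h | h
    · exact absurd h hc
    · linarith
  rw [Ideal.mem_span_pair]
  refine ⟨Polynomial.C (Polynomial.C (u 0 - gr * u 1)), Polynomial.C (Polynomial.C (u 1)), ?_⟩
  rw [h2]
  simp only [Polynomial.C_add, Polynomial.C_mul, Polynomial.C_sub, Polynomial.C_neg]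
  ring

theorem Om_zero {F : P4} (hn : F.IsHomogeneous 72) (hF : ∀ v ∈ roots, F ∈ Iperp (vr v) ^ 20) (k : ℕ)
    (hk : k < 7) : (Om (act (shear gr) F)).coeff k = 0 := by
  set f := (Om (act (shear gr) F)).coeff k with hf
  have hg := gr_sq
  have hp := gr_pos
  have d0 : (Polynomial.X - Polynomial.C 0) ^ (20 - k) ∣ f :=
    Om_coeff_dvd (hF ⟨⟨0, 0⟩, ⟨0, 0⟩, ⟨-2, 0⟩, ⟨0, 0⟩⟩ (by decide +kernel)) (-2) 0 (by norm_num)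
      (by funext i; fin_cases i <;> simp [vr, zr]) k
  have h1 : gr - 1 ≠ 0 := by intro h; nlinarith
  have h2 : gr ≠ 0 := hp.ne'
  have d1 : (Polynomial.X - Polynomial.C gr) ^ (20 - k) ∣ f :=
    Om_coeff_dvd (hF ⟨⟨1, 0⟩, ⟨0, -1⟩, ⟨-1, 1⟩, ⟨0, 0⟩⟩ (by decide +kernel)) (gr - 1) gr h1
      (by funext i; fin_cases i <;> simp [vr, zr] <;> nlinarith) k
  have d2 : (Polynomial.X - Polynomial.C (-gr)) ^ (20 - k) ∣ f :=
    Om_coeff_dvd (hF ⟨⟨-1, 0⟩, ⟨0, 1⟩, ⟨-1, 1⟩, ⟨0, 0⟩⟩ (by decide +kernel)) (gr - 1) (-gr) h1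
      (by funext i; fin_cases i <;> simp [vr, zr] <;> nlinarith) k
  have d3 : (Polynomial.X - Polynomial.C (2 - gr)) ^ (20 - k) ∣ f :=
    Om_coeff_dvd (hF ⟨⟨-1, 1⟩, ⟨-1, 0⟩, ⟨0, 1⟩, ⟨0, 0⟩⟩ (by decide +kernel)) gr (2 - gr) h2
      (by funext i; fin_cases i <;> simp [vr, zr] <;> nlinarith) k
  have d4 : (Polynomial.X - Polynomial.C (gr - 2)) ^ (20 - k) ∣ f :=
    Om_coeff_dvd (hF ⟨⟨1, -1⟩, ⟨1, 0⟩, ⟨0, 1⟩, ⟨0, 0⟩⟩ (by decide +kernel)) gr (gr - 2) h2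
      (by funext i; fin_cases i <;> simp [vr, zr] <;> nlinarith) k
  have cp : ∀ a b : ℝ, a ≠ b → IsCoprime ((Polynomial.X - Polynomial.C a) ^ (20 - k))
      ((Polynomial.X - Polynomial.C b) ^ (20 - k)) := fun a b hab =>
    (Polynomial.isCoprime_X_sub_C_of_isUnit_sub
      (isUnit_iff_ne_zero.mpr (sub_ne_zero.mpr hab))).pow
  have hlt : 1 < gr := by nlinarith
  have hlt2 : gr < 2 := by nlinarith
  have hlt3 : 3 / 2 < gr := by nlinarith
  have D1 := (cp 0 gr (by linarith)).mul_dvd d0 d1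
  have D2 := (IsCoprime.mul_left (cp 0 (-gr) (by linarith)) (cp gr (-gr) (by linarith))).mul_dvd D1 d2
  have D3 := (IsCoprime.mul_left (IsCoprime.mul_left (cp 0 (2 - gr) (by linarith))
    (cp gr (2 - gr) (by linarith))) (cp (-gr) (2 - gr) (by linarith))).mul_dvd D2 d3
  have D4 := (IsCoprime.mul_left (IsCoprime.mul_left (IsCoprime.mul_left (cp 0 (gr - 2) (by linarith))
    (cp gr (gr - 2) (by linarith))) (cp (-gr) (gr - 2) (by linarith)))
    (cp (2 - gr) (gr - 2) (by linarith))).mul_dvd D3 d4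
  by_contra h0
  have hdeg := Polynomial.natDegree_le_of_dvd D4 h0
  have hle := Om_deg (act_homog (shear gr) hn) k
  rw [← hf] at hle
  have nz : ∀ a : ℝ, ((Polynomial.X - Polynomial.C a) ^ (20 - k)) ≠ 0 :=
    fun a => pow_ne_zero _ (Polynomial.X_sub_C_ne_zero a)
  rw [Polynomial.natDegree_mul (mul_ne_zero (mul_ne_zero (mul_ne_zero (nz _) (nz _)) (nz _)) (nz _))
      (nz _),
    Polynomial.natDegree_mul (mul_ne_zero (mul_ne_zero (nz _) (nz _)) (nz _)) (nz _),
    Polynomial.natDegree_mul (mul_ne_zero (nz _) (nz _)) (nz _),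
    Polynomial.natDegree_mul (nz _) (nz _)] at hdeg
  simp only [Polynomial.natDegree_pow, Polynomial.natDegree_X_sub_C] at hdeg
  omega

theorem axis_dvd {F : P4} (hn : F.IsHomogeneous 72) (hF : ∀ v ∈ roots, F ∈ Iperp (vr v) ^ 20) :
    lin ![gr, 1, 0, 0] ^ 7 ∣ kill 3 F := by
  have h1 := X_pow_dvd_kill (act_homog (shear gr) hn) (Om_zero hn hF)
  have h2 := map_dvd (act (shear (-gr))) h1
  have e1 : act (shear (-gr)) (kill 3 (act (shear gr) F)) = kill 3 F := by
    apply MvPolynomial.funext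
    intro v
    rw [eval_act, eval_kill, eval_kill, eval_act]
    congr 2
    rw [shear_mulVec, shear_mulVec]
    funext i
    fin_cases i <;> simp [Function.update]
  have e2 : act (shear (-gr)) (X 1) = lin ![gr, 1, 0, 0] := by
    simp only [act, aeval_X]
    congr 1
    funext i
    fin_cases i <;> simp [shear]
  rwa [e1, map_pow, e2] at h2

end H4

namespace H4

theorem InvG.m1 {F : P4} (h : InvG F) (a b c d : ℝ) :
    eval ![-a, b, c, d] F = eval ![a, b, c, d] F := by
  have := h 0 ![a, b, c, d]
  change eval (_root_.m1 *ᵥ _) F = _ at this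
  rw [m1_mulVec] at this; simpa using this

theorem InvG.m2 {F : P4} (h : InvG F) (a b c d : ℝ) :
    eval ![a, -b, c, d] F = eval ![a, b, c, d] F := by
  have := h 1 ![a, b, c, d]
  change eval (_root_.m2 *ᵥ _) F = _ at this
  rw [m2_mulVec] at this; simpa using this

theorem InvG.m4 {F : P4} (h : InvG F) (a b c d : ℝ) :
    eval ![-c, d, a, -b] F = eval ![a, b, c, d] F := by
  have := h 3 ![a, b, c, d]
  change eval (_root_.m4 *ᵥ _) F = _ at this
  rw [m4_mulVec] at this; simpa using this

theorem InvG.flipw {F : P4} (h : InvG F) (a b c d : ℝ) :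
    eval ![a, b, c, -d] F = eval ![a, b, c, d] F := by
  have h1 := h.m4 c d (-a) b
  have h2 := h.m4 c (-d) (-a) b
  rw [h.m2] at h2
  simp only [neg_neg] at h1 h2
  rw [h1, h2]

theorem vec4 (v : Fin 4 → ℝ) : v = ![v 0, v 1, v 2, v 3] := by
  funext i; fin_cases i <;> rfl

theorem update3 (v : Fin 4 → ℝ) (c : ℝ) : Function.update v 3 c = ![v 0, v 1, v 2, c] := by
  funext i; fin_cases i <;> simp [Function.update]

theorem update1 (v : Fin 4 → ℝ) (c : ℝ) : Function.update v 1 c = ![v 0, c, v 2, v 3] := by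
  funext i; fin_cases i <;> simp [Function.update]

theorem InvG.invH_kill {F : P4} (h : InvG F) : InvH (kill 3 F) := by
  intro k hk v
  rw [eval_kill, eval_kill, update3, update3]
  have key := h k ![v 0, v 1, v 2, 0]
  rw [← key]
  congr 2
  fin_cases k
  · change ![(_root_.m1 *ᵥ v) 0, (_root_.m1 *ᵥ v) 1, (_root_.m1 *ᵥ v) 2, 0] = _root_.m1 *ᵥ _
    rw [m1_mulVec, m1_mulVec]; simp
  · change ![(_root_.m2 *ᵥ v) 0, (_root_.m2 *ᵥ v) 1, (_root_.m2 *ᵥ v) 2, 0] = _root_.m2 *ᵥ _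
    rw [m2_mulVec, m2_mulVec]; simp
  · change ![(_root_.m3 *ᵥ v) 0, (_root_.m3 *ᵥ v) 1, (_root_.m3 *ᵥ v) 2, 0] = _root_.m3 *ᵥ _
    rw [m3_mulVec, m3_mulVec]; simp
  · simp at hk

theorem kill_homog (i : Fin 4) {F : P4} {n : ℕ} (hF : F.IsHomogeneous n) :
    (kill i F).IsHomogeneous n := by
  have := hF.aeval (fun j => if j = i then (0 : P4) else X j) (n := 1) (by
    intro j
    by_cases h : j = i
    · simp only [h, if_true]; exact MvPolynomial.isHomogeneous_zero _ _ _
    · simp only [h, if_false]; exact MvPolynomial.isHomogeneous_X _ _)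
  simpa [kill] using this

/-! ### reflections -/

def Refl (F : P4) (R : Fin 4 → ℝ) : Prop :=
  ∀ v, eval (v - ((R ⬝ᵥ v) / 2) • R) F = eval v F

theorem refl_roots {F : P4} (hF : InvG F) : ∀ v ∈ roots, Refl F (vr v) := by
  apply roots_closure (Refl F)
  · intro k R hR v
    have h1 : v - ((gens k *ᵥ R ⬝ᵥ v) / 2) • (gens k *ᵥ R) =
        gens k *ᵥ ((gens k)ᵀ *ᵥ v - ((R ⬝ᵥ ((gens k)ᵀ *ᵥ v)) / 2) • R) := by
      rw [Matrix.mulVec_sub, Matrix.mulVec_mulVec, gens_orth', Matrix.one_mulVec,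
        Matrix.mulVec_smul, Matrix.dotProduct_mulVec, Matrix.vecMul_transpose]
    rw [h1, hF k, hR, hF.evalT]
  · intro v
    have : v - ((vr ⟨⟨0, 0⟩, ⟨0, 0⟩, ⟨0, 0⟩, ⟨2, 0⟩⟩ ⬝ᵥ v) / 2) •
        vr ⟨⟨0, 0⟩, ⟨0, 0⟩, ⟨0, 0⟩, ⟨2, 0⟩⟩ = ![v 0, v 1, v 2, - v 3] := by
      funext i
      fin_cases i <;> simp [vr, zr, dotProduct, Fin.sum_univ_four]
      ring
    rw [this, hF.flipw, ← vec4]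

/-! ### restriction to lines -/

noncomputable def ln (q u : Fin 4 → ℝ) : P4 →ₐ[ℝ] Polynomial ℝ :=
  aeval (fun i => Polynomial.C (q i) + Polynomial.C (u i) * Polynomial.X)

theorem eval_ln (q u : Fin 4 → ℝ) (F : P4) (e : ℝ) :
    (ln q u F).eval e = eval (fun i => q i + u i * e) F := by
  unfold ln
  induction F using MvPolynomial.induction_on with
  | C a => simp
  | add p q hp hq => rw [map_add, map_add, Polynomial.eval_add, hp, hq]
  | mul_X p i hp => rw [map_mul, map_mul, Polynomial.eval_mul, hp, aeval_X, eval_X]; simp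

theorem deriv_ln (q u : Fin 4 → ℝ) (F : P4) :
    (Polynomial.derivative (ln q u F)).eval 0 = ∑ i, u i * eval q (pderiv i F) := by
  have h0 : ∀ p, (ln q u p).eval 0 = eval q p := by
    intro p; rw [eval_ln]; simp
  induction F using MvPolynomial.induction_on with
  | C a => simp [ln]
  | add p q hp hq =>
    simp only [map_add, Polynomial.eval_add, hp, hq, mul_add, Finset.sum_add_distrib]
  | mul_X p j hp =>
    have : ln q u (X j) = Polynomial.C (q j) + Polynomial.C (u j) * Polynomial.X := by simp [ln]
    rw [map_mul, Polynomial.derivative_mul, Polynomial.eval_add, Polynomial.eval_mul,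
      Polynomial.eval_mul, hp, h0, h0, this]
    simp only [Derivation.leibniz, pderiv_X, smul_eq_mul, map_add, map_mul, eval_X, mul_add,
      Finset.sum_add_distrib]
    rw [Finset.sum_mul]
    simp only [Polynomial.derivative_add, Polynomial.derivative_C, Polynomial.derivative_C_mul,
      Polynomial.derivative_X, Polynomial.eval_add, Polynomial.eval_mul, Polynomial.eval_C,
      Polynomial.eval_one, Polynomial.eval_zero]
    rw [add_comm]
    congr 1
    · rw [Finset.sum_eq_single j]
      · simp; ring
      · intro i _ hi; simp [Pi.single_apply, hi.symm]
      · simp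
    · apply Finset.sum_congr rfl; intro i _; ring

theorem rest_ne : ∀ l : List (V4 × Nat), l.all (fun a => znz (zadd a.1.x a.1.z)) = true →
    eval ![1, 0, 1, 0] (lprod l) ≠ 0 := by
  intro l
  induction l with
  | nil => intro _; simp [lprod]
  | cons a l ih =>
    intro h
    rw [List.all_cons, Bool.and_eq_true] at h
    rw [lprod_cons, map_mul, map_pow, eval_lin]
    refine mul_ne_zero (pow_ne_zero _ ?_) (ih h.2)
    have := zr_ne h.1
    rw [zr_add] at this
    simpa [dotProduct, Fin.sum_univ_four, vr] using this

def hall : List (V4 × Nat) := hroots.map (fun v => (v, 2)) ++ axes.map (fun v => (v, 7))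

theorem quad_rel {F U V : P4} (hF : InvG F) (h : F = X 1 ^ 2 * U + X 3 ^ 2 * V) :
    eval ![1, 0, 1, 0] U = 0 := by
  have hR := refl_roots hF ⟨⟨-1, 0⟩, ⟨-1, 0⟩, ⟨1, 0⟩, ⟨-1, 0⟩⟩ (by decide +kernel)
  have hv : vr ⟨⟨-1, 0⟩, ⟨-1, 0⟩, ⟨1, 0⟩, ⟨-1, 0⟩⟩ = ![-1, -1, 1, -1] := by
    funext i; fin_cases i <;> simp [vr, zr]
  rw [hv] at hR
  have sub0 : ∀ P : Polynomial ℝ, (∀ e : ℝ, e ^ 2 * P.eval e = 0) → P.eval 0 = 0 := by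
    intro P hP
    have : Polynomial.X ^ 2 * P = 0 := by
      apply Polynomial.funext; intro e; simpa using hP e
    rcases mul_eq_zero.mp this with h | h
    · simp at h
    · rw [h]; simp
  have e1 : 4 * eval ![1, 0, 1, 0] U - eval ![1, 0, 1, 0] U - eval ![1, 0, 1, 0] V = 0 := by
    have := sub0 (4 * ln ![1, 0, 1, 0] ![0, 1, 0, 0] U -
      ln ![1, 0, 1, 0] ![-1/2, 1/2, 1/2, -1/2] U - ln ![1, 0, 1, 0] ![-1/2, 1/2, 1/2, -1/2] V) ?_
    · simpa [eval_ln, ← vec4] using this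
    · intro e
      have := hR ![1, e, 1, 0]
      have hs : ![1, e, 1, 0] - ((![-1, -1, 1, -1] ⬝ᵥ ![1, e, 1, 0]) / 2) •
          (![-1, -1, 1, -1] : Fin 4 → ℝ) =
          fun i => (![1, 0, 1, 0] : Fin 4 → ℝ) i + ![-1/2, 1/2, 1/2, -1/2] i * e := by
        funext i
        fin_cases i <;> simp [dotProduct, Fin.sum_univ_four] <;> ring
      have hs' : (![1, e, 1, 0] : Fin 4 → ℝ) =
          fun i => (![1, 0, 1, 0] : Fin 4 → ℝ) i + ![0, 1, 0, 0] i * e := by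
        funext i
        fin_cases i <;> simp
      rw [hs, hs', h] at this
      simp only [map_add, map_mul, map_pow, eval_X] at this
      simp only [Polynomial.eval_sub, Polynomial.eval_mul, eval_ln]
      simp [-mul_eq_zero] at this ⊢
      linear_combination -4 * this
  have e2 : 4 * eval ![1, 0, 1, 0] V - eval ![1, 0, 1, 0] U - eval ![1, 0, 1, 0] V = 0 := by
    have := sub0 (4 * ln ![1, 0, 1, 0] ![0, 0, 0, 1] V -
      ln ![1, 0, 1, 0] ![-1/2, -1/2, 1/2, 1/2] U - ln ![1, 0, 1, 0] ![-1/2, -1/2, 1/2, 1/2] V) ?_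
    · simpa [eval_ln, ← vec4] using this
    · intro e
      have := hR ![1, 0, 1, e]
      have hs : ![1, 0, 1, e] - ((![-1, -1, 1, -1] ⬝ᵥ ![1, 0, 1, e]) / 2) •
          (![-1, -1, 1, -1] : Fin 4 → ℝ) =
          fun i => (![1, 0, 1, 0] : Fin 4 → ℝ) i + ![-1/2, -1/2, 1/2, 1/2] i * e := by
        funext i
        fin_cases i <;> simp [dotProduct, Fin.sum_univ_four] <;> ring
      have hs' : (![1, 0, 1, e] : Fin 4 → ℝ) =
          fun i => (![1, 0, 1, 0] : Fin 4 → ℝ) i + ![0, 0, 0, 1] i * e := by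
        funext i
        fin_cases i <;> simp
      rw [hs, hs', h] at this
      simp only [map_add, map_mul, map_pow, eval_X] at this
      simp only [Polynomial.eval_sub, Polynomial.eval_mul, eval_ln]
      simp [-mul_eq_zero] at this ⊢
      linear_combination -4 * this
  linarith

theorem X3_decomp {F : P4} (hF : InvG F) : X 3 ^ 2 ∣ F - kill 3 F := by
  apply X_sq_dvd
  · intro v hv
    rw [map_sub, eval_kill]
    have : Function.update v 3 0 = v := by rw [← hv]; simp
    rw [this, sub_self]
  · intro v
    rw [map_sub, map_sub, eval_kill, eval_kill, Function.update_idem, update3, hF.flipw, ← vec4]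

theorem inj {F : P4} (hn : F.IsHomogeneous 72) (hF : InvG F)
    (hm : F ∈ (Ideal.span {X 0, X 1, X 2} : Ideal P4) ^ 20)
    (h0 : ∀ t : ℝ, eval ![t, 0, 1, 0] F = 0) : F = 0 := by
  have hx : X 1 ^ 2 ∣ kill 3 F := by
    apply X_sq_dvd
    · intro v hv
      rw [eval_kill, update3, hv]
      by_cases hz : v 2 = 0
      · have h1 := hF.m4 0 0 (-v 0) 0
        have h2 := eval_smul_homog hn (-v 0) ![0, 0, 1, 0]
        rw [h0] at h2
        have e : (fun i => -v 0 * (![0, 0, 1, 0] : Fin 4 → ℝ) i) = ![0, 0, - v 0, 0] := by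
          funext i; fin_cases i <;> simp
        rw [e] at h2
        simp at h1
        rw [hz, h1, h2]; simp
      · have h2 := eval_smul_homog hn (v 2) ![v 0 / v 2, 0, 1, 0]
        rw [h0] at h2
        have e : (fun i => v 2 * (![v 0 / v 2, 0, 1, 0] : Fin 4 → ℝ) i) = ![v 0, 0, v 2, 0] := by
          funext i; fin_cases i <;> simp; field_simp
        rw [e] at h2
        rw [h2]; simp
    · intro v
      rw [eval_kill, eval_kill, update1, update3, update3]
      simpa using hF.m2 (v 0) (v 1) (v 2) 0
  have hH := hF.invH_kill
  have r1 := hroots_dvd hH hx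
  have r2 := axes_dvd hH (axis_dvd hn (mult_roots hF hm))
  have hd : lprod hall ∣ kill 3 F := by
    apply lprod_dvd _ _ hroots_pw
    intro a ha
    rw [List.mem_append, List.mem_map, List.mem_map] at ha
    rcases ha with ⟨v, hv, rfl⟩ | ⟨v, hv, rfl⟩
    · exact r1 v hv
    · exact r2 v hv
  have hdeg : (hall.map Prod.snd).sum = 72 := by decide +kernel
  obtain ⟨c, hc⟩ := eq_C_of_dvd (kill_homog 3 hn) (hdeg ▸ lprod_homog hall) hd
  have hall_eq : hall = (⟨⟨0, 0⟩, ⟨2, 0⟩, ⟨0, 0⟩, ⟨0, 0⟩⟩, 2) :: hall.tail := by decide +kernel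
  have hl : lprod hall = X 1 ^ 2 * (C 4 * lprod hall.tail) := by
    rw [hall_eq, lprod_cons]
    have : vr ⟨⟨0, 0⟩, ⟨2, 0⟩, ⟨0, 0⟩, ⟨0, 0⟩⟩ = Pi.single 1 2 := by
      funext i; fin_cases i <;> simp [vr, zr]
    simp only [this, lin_single, List.tail_cons]
    rw [mul_pow, ← map_pow]; norm_num; ring
  obtain ⟨V, hV⟩ := X3_decomp hF
  have hFe : F = X 1 ^ 2 * (C c * (C 4 * lprod hall.tail)) + X 3 ^ 2 * V := by
    rw [← hV, hc, hl]; ring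
  have hq := quad_rel hF hFe
  have hne : eval ![1, 0, 1, 0] (lprod hall.tail) ≠ 0 := rest_ne _ (by decide +kernel)
  have hc0 : c = 0 := by
    simp only [map_mul, eval_C] at hq
    rcases mul_eq_zero.mp hq with h | h
    · exact h
    · exfalso
      rcases mul_eq_zero.mp h with h | h
      · norm_num at h
      · exact hne h
  apply zero_of_H4 hF hn
  rw [hFe, hc0]
  simp

end H4

namespace H4

noncomputable def Ph (F : P4) : Polynomial ℝ := ln ![0, 0, 1, 0] ![1, 0, 0, 0] F

theorem eval_Ph (F : P4) (t : ℝ) : (Ph F).eval t = eval ![t, 0, 1, 0] F := by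
  rw [Ph, eval_ln]
  congr 2
  funext i; fin_cases i <;> simp

theorem Ph_kill (F : P4) : Ph (kill 3 F) = Ph F := by
  apply Polynomial.funext
  intro t
  rw [eval_Ph, eval_Ph, eval_kill, update3]
  simp

theorem Ph_alt {F : P4} (hF : InvG F) : ln ![-1, 0, 0, 0] ![0, 0, 1, 0] F = Ph F := by
  apply Polynomial.funext
  intro t
  have := hF.m4 t 0 1 0
  rw [eval_ln, eval_Ph, ← this]
  congr 2
  funext i; fin_cases i <;> simp

theorem Ph_lin (u : Fin 4 → ℝ) : Ph (lin u) =
    Polynomial.C (u 2) + Polynomial.C (u 0) * Polynomial.X := by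
  apply Polynomial.funext
  intro t
  rw [eval_Ph, eval_lin]
  simp [dotProduct, Fin.sum_univ_four]; ring

theorem Ph_alt_lin (u : Fin 4 → ℝ) : ln ![-1, 0, 0, 0] ![0, 0, 1, 0] (lin u) =
    Polynomial.C (- u 0) + Polynomial.C (u 2) * Polynomial.X := by
  apply Polynomial.funext
  intro t
  rw [eval_ln, eval_lin]
  simp [dotProduct, Fin.sum_univ_four]

theorem Ph_X20 {F : P4} (hF : ∀ v ∈ roots, F ∈ Iperp (vr v) ^ 20) : Polynomial.X ^ 20 ∣ Ph F := by
  rw [← Ideal.mem_span_singleton, ← Ideal.span_singleton_pow]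
  refine mem_map_pow (ln ![0, 0, 1, 0] ![1, 0, 0, 0])
    (hF ⟨⟨0, 0⟩, ⟨0, 0⟩, ⟨-2, 0⟩, ⟨0, 0⟩⟩ (by decide +kernel)) ?_
  intro u hu
  have := Ph_lin u
  rw [Ph] at this
  rw [this]
  have h2 : u 2 = 0 := by
    simpa [dotProduct, Fin.sum_univ_four, vr, zr] using hu
  rw [h2, Ideal.mem_span_singleton]
  simp

theorem Ph_recip {F : P4} (hn : F.IsHomogeneous 72) (hF : InvG F) (t : ℝ) (ht : t ≠ 0) :
    (Ph F).eval t = t ^ 72 * (Ph F).eval t⁻¹ := by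
  rw [eval_Ph, eval_Ph, ← eval_smul_homog hn t, ← hF.m4 t 0 1 0, neg_zero, hF.m1]
  congr 2
  funext i; fin_cases i <;> simp [ht]

theorem Ph_deg {F : P4} (hn : F.IsHomogeneous 72) (hF : InvG F)
    (hm : ∀ v ∈ roots, F ∈ Iperp (vr v) ^ 20) : (Ph F).natDegree ≤ 52 := by
  obtain ⟨Q, hQ⟩ := Ph_X20 hm
  by_cases h0 : Q = 0
  · rw [hQ, h0]; simp
  have key : Polynomial.X * (Polynomial.X ^ Q.natDegree * Ph F) =
      Polynomial.X * (Polynomial.X ^ 52 * Q.reverse) := by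
    apply Polynomial.funext
    intro t
    by_cases ht : t = 0
    · simp [ht]
    have h1 := Ph_recip hn hF t ht
    have h2 : Q.reverse.eval t = t ^ Q.natDegree * Q.eval t⁻¹ := by
      have hi : t⁻¹ ≠ 0 := inv_ne_zero ht
      letI : Invertible t⁻¹ := invertibleOfNonzero hi
      have := Polynomial.eval₂_reverse_mul_pow (RingHom.id ℝ) t⁻¹ Q
      simp only [invOf_eq_inv, inv_inv, Polynomial.eval₂_id] at this
      rw [← this, inv_pow, mul_left_comm, mul_inv_cancel₀ (pow_ne_zero _ ht), mul_one]
    simp only [Polynomial.eval_mul, Polynomial.eval_pow, Polynomial.eval_X]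
    rw [h2, h1, hQ]
    simp only [Polynomial.eval_mul, Polynomial.eval_pow, Polynomial.eval_X]
    field_simp
  have key2 := mul_left_cancel₀ Polynomial.X_ne_zero key
  have hP0 : Ph F ≠ 0 := by
    rw [hQ]; exact mul_ne_zero (pow_ne_zero _ Polynomial.X_ne_zero) h0
  have hr0 : Q.reverse ≠ 0 := by
    rwa [Ne, Polynomial.reverse_eq_zero]
  have hd := congrArg Polynomial.natDegree key2
  rw [Polynomial.natDegree_mul (pow_ne_zero _ Polynomial.X_ne_zero) hP0,
    Polynomial.natDegree_mul (pow_ne_zero _ Polynomial.X_ne_zero) hr0,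
    Polynomial.natDegree_X_pow, Polynomial.natDegree_X_pow] at hd
  have h3 := Polynomial.reverse_natDegree_le Q
  omega

theorem axes_kill {F : P4} (hn : F.IsHomogeneous 72) (hF : InvG F)
    (hm : ∀ v ∈ roots, F ∈ Iperp (vr v) ^ 20) : ∀ v ∈ axes, lin (vr v) ^ 7 ∣ kill 3 F :=
  axes_dvd hF.invH_kill (axis_dvd hn hm)

theorem dvd_of_C {p q F : Polynomial ℝ} (c : ℝ) (hc : c ≠ 0) (h : p ^ 7 ∣ F)
    (hp : p = Polynomial.C c * q) : q ^ 7 ∣ F := by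
  refine dvd_trans ?_ h
  rw [hp, mul_pow]
  exact Dvd.intro_left _ rfl

theorem prod_id : (Polynomial.X ^ 20 * (Polynomial.X ^ 4 - 3 * Polynomial.X ^ 2 + 1) ^ 7 : Polynomial ℝ) =
    (Polynomial.X - Polynomial.C 0) ^ 20 * (Polynomial.X - Polynomial.C gr) ^ 7 *
    (Polynomial.X - Polynomial.C (-gr)) ^ 7 * (Polynomial.X - Polynomial.C (1 - gr)) ^ 7 *
    (Polynomial.X - Polynomial.C (gr - 1)) ^ 7 := by
  have hC : (Polynomial.C gr * Polynomial.C gr : Polynomial ℝ) = Polynomial.C gr + 1 := by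
    rw [← Polynomial.C_mul, gr_sq]; simp
  have e : (Polynomial.X ^ 4 - 3 * Polynomial.X ^ 2 + 1 : Polynomial ℝ) =
      (Polynomial.X - Polynomial.C gr) * (Polynomial.X - Polynomial.C (-gr)) *
      (Polynomial.X - Polynomial.C (1 - gr)) * (Polynomial.X - Polynomial.C (gr - 1)) := by
    simp only [Polynomial.C_sub, Polynomial.C_neg, map_one]
    linear_combination (-2 * Polynomial.X ^ 2 + Polynomial.C gr * Polynomial.C gr -
      Polynomial.C gr + 1) * hC * (-1)
  rw [e, mul_pow, mul_pow, mul_pow, Polynomial.C_0, sub_zero]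
  simp only [mul_assoc]

theorem comb {P : Polynomial ℝ} (h0 : (Polynomial.X - Polynomial.C 0) ^ 20 ∣ P)
    (c1 : (Polynomial.X - Polynomial.C gr) ^ 7 ∣ P)
    (c2 : (Polynomial.X - Polynomial.C (-gr)) ^ 7 ∣ P)
    (c3 : (Polynomial.X - Polynomial.C (1 - gr)) ^ 7 ∣ P)
    (c4 : (Polynomial.X - Polynomial.C (gr - 1)) ^ 7 ∣ P) :
    (Polynomial.X ^ 20 * (Polynomial.X ^ 4 - 3 * Polynomial.X ^ 2 + 1) ^ 7 : Polynomial ℝ) ∣ P := by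
  have hg := gr_sq
  have hp := gr_pos
  have cp : ∀ (a b : ℝ) (n m : ℕ), a ≠ b → IsCoprime ((Polynomial.X - Polynomial.C a) ^ n)
      ((Polynomial.X - Polynomial.C b) ^ m) := fun a b n m hab =>
    (Polynomial.isCoprime_X_sub_C_of_isUnit_sub
      (isUnit_iff_ne_zero.mpr (sub_ne_zero.mpr hab))).pow
  have hlt : 1 < gr := by nlinarith
  rw [prod_id]
  refine IsCoprime.mul_dvd ?_ (IsCoprime.mul_dvd ?_ (IsCoprime.mul_dvd ?_
    (IsCoprime.mul_dvd ?_ h0 c1) c2) c3) c4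
  · refine IsCoprime.mul_left (IsCoprime.mul_left (IsCoprime.mul_left ?_ ?_) ?_) ?_ <;>
      apply cp <;> intro h <;> linarith
  · refine IsCoprime.mul_left (IsCoprime.mul_left ?_ ?_) ?_ <;>
      apply cp <;> intro h <;> linarith
  · refine IsCoprime.mul_left ?_ ?_ <;> apply cp <;> intro h <;> linarith
  · apply cp; intro h; linarith

theorem Ph_dvd {F : P4} (hn : F.IsHomogeneous 72) (hF : InvG F)
    (hm : ∀ v ∈ roots, F ∈ Iperp (vr v) ^ 20) :
    (Polynomial.X ^ 20 * (Polynomial.X ^ 4 - 3 * Polynomial.X ^ 2 + 1) ^ 7 : Polynomial ℝ) ∣ Ph F := by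
  have hg := gr_sq
  have hp := gr_pos
  have a1 := axes_kill hn hF hm ⟨⟨-1, 0⟩, ⟨0, 0⟩, ⟨0, 1⟩, ⟨0, 0⟩⟩ (by decide +kernel)
  have a2 := axes_kill hn hF hm ⟨⟨1, 0⟩, ⟨0, 0⟩, ⟨0, 1⟩, ⟨0, 0⟩⟩ (by decide +kernel)
  have v1 : vr ⟨⟨-1, 0⟩, ⟨0, 0⟩, ⟨0, 1⟩, ⟨0, 0⟩⟩ = ![-1, 0, gr, 0] := by
    funext i; fin_cases i <;> simp [vr, zr]
  have v2 : vr ⟨⟨1, 0⟩, ⟨0, 0⟩, ⟨0, 1⟩, ⟨0, 0⟩⟩ = ![1, 0, gr, 0] := by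
    funext i; fin_cases i <;> simp [vr, zr]
  rw [v1] at a1
  rw [v2] at a2
  have altk : ln ![-1, 0, 0, 0] ![0, 0, 1, 0] (kill 3 F) = Ph F := by
    rw [← Ph_alt hF]
    apply Polynomial.funext
    intro t
    rw [eval_ln, eval_ln, eval_kill]
    congr 2
    funext i; fin_cases i <;> simp [Function.update]
  have b1 := map_dvd (ln ![0, 0, 1, 0] ![1, 0, 0, 0]) a1
  have b2 := map_dvd (ln ![0, 0, 1, 0] ![1, 0, 0, 0]) a2
  have b3 := map_dvd (ln ![-1, 0, 0, 0] ![0, 0, 1, 0]) a1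
  have b4 := map_dvd (ln ![-1, 0, 0, 0] ![0, 0, 1, 0]) a2
  rw [map_pow] at b1 b2 b3 b4
  change (Ph _) ^ 7 ∣ Ph _ at b1
  change (Ph _) ^ 7 ∣ Ph _ at b2
  rw [Ph_kill, Ph_lin] at b1 b2
  rw [altk, Ph_alt_lin] at b3 b4
  have h0 := Ph_X20 hm
  rw [← sub_zero Polynomial.X, ← Polynomial.C_0] at h0
  have c1 : (Polynomial.X - Polynomial.C gr) ^ 7 ∣ Ph F :=
    dvd_of_C (-1) (by norm_num) b1 (by simp; ring)
  have c2 : (Polynomial.X - Polynomial.C (-gr)) ^ 7 ∣ Ph F :=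
    dvd_of_C 1 (by norm_num) b2 (by simp; ring)
  have hC : (Polynomial.C gr * Polynomial.C gr : Polynomial ℝ) = Polynomial.C gr + 1 := by
    rw [← Polynomial.C_mul, hg]; simp
  have c3 : (Polynomial.X - Polynomial.C (1 - gr)) ^ 7 ∣ Ph F :=
    dvd_of_C gr hp.ne' b3 (by simp; linear_combination hC * (-1))
  have c4 : (Polynomial.X - Polynomial.C (gr - 1)) ^ 7 ∣ Ph F :=
    dvd_of_C gr hp.ne' b4 (by simp; linear_combination hC)
  exact comb h0 c1 c2 c3 c4

/-- the gradient condition -/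
theorem Ph_grad {F : P4} (hn : F.IsHomogeneous 72) (hF : InvG F) :
    (Polynomial.derivative (Ph F)).eval (-(gr + 1)) = -24 * (Ph F).eval (-(gr + 1)) := by
  have hg := gr_sq
  set q : Fin 4 → ℝ := ![-(gr + 1), 0, 1, 0] with hq
  set g : Fin 4 → ℝ := fun i => eval q (pderiv i F) with hgdef
  have inv : ∀ (k : Fin 4) (u : Fin 4 → ℝ), gens k *ᵥ q = q →
      ln q (gens k *ᵥ u) F = ln q u F := by
    intro k u hk
    apply Polynomial.funext
    intro e
    rw [eval_ln, eval_ln, ← hF k (fun i => q i + u i * e)]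
    congr 2
    have : (fun i => q i + u i * e) = q + e • u := by funext i; simp [mul_comm]
    rw [this, Matrix.mulVec_add, hk, Matrix.mulVec_smul]
    funext i; simp [mul_comm]
  have h1 : g 1 = 0 := by
    have := inv 1 ![0, 1, 0, 0] (by
      change m2 *ᵥ q = q
      rw [m2_mulVec]; funext i; fin_cases i <;> simp [hq])
    have h2 := congrArg (fun p => (Polynomial.derivative p).eval 0) this
    simp only [deriv_ln, Fin.sum_univ_four] at h2
    change (m2 *ᵥ _) 0 * g 0 + (m2 *ᵥ _) 1 * g 1 + (m2 *ᵥ _) 2 * g 2 + (m2 *ᵥ _) 3 * g 3 =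
      _ * g 0 + _ * g 1 + _ * g 2 + _ * g 3 at h2
    rw [m2_mulVec] at h2
    simp at h2
    linarith
  have h2 : g 2 = (gr - 2) * g 0 := by
    have := inv 2 ![1, 0, 0, 0] (by
      change m3 *ᵥ q = q
      rw [m3_mulVec]; funext i; fin_cases i <;> simp [hq] <;> linarith)
    have h2 := congrArg (fun p => (Polynomial.derivative p).eval 0) this
    simp only [deriv_ln, Fin.sum_univ_four] at h2
    change (m3 *ᵥ _) 0 * g 0 + (m3 *ᵥ _) 1 * g 1 + (m3 *ᵥ _) 2 * g 2 + (m3 *ᵥ _) 3 * g 3 =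
      _ * g 0 + _ * g 1 + _ * g 2 + _ * g 3 at h2
    rw [m3_mulVec, h1] at h2
    simp at h2
    linarith
  have h3 : -(gr + 1) * g 0 + g 2 = 72 * eval q F := by
    have e : ln q q F = Polynomial.C (eval q F) * (1 + Polynomial.X) ^ 72 := by
      apply Polynomial.funext
      intro e
      rw [eval_ln]
      have := eval_smul_homog hn (1 + e) q
      simp only [Polynomial.eval_mul, Polynomial.eval_C, Polynomial.eval_pow, Polynomial.eval_add,
        Polynomial.eval_one, Polynomial.eval_X]
      rw [mul_comm, ← this]
      congr 2
      funext i; ring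
    have h4 := congrArg (fun p => (Polynomial.derivative p).eval 0) e
    simp only [deriv_ln, Fin.sum_univ_four] at h4
    change q 0 * g 0 + q 1 * g 1 + q 2 * g 2 + q 3 * g 3 = _ at h4
    have h6 : Polynomial.eval 0 (Polynomial.derivative (Polynomial.C (eval q F) *
        (1 + Polynomial.X) ^ 72)) = 72 * eval q F := by
      generalize eval q F = E
      rw [Polynomial.derivative_C_mul, Polynomial.derivative_pow]
      simp; ring
    rw [h6] at h4
    have q0 : q 0 = -(gr + 1) := rfl
    have q1 : q 1 = 0 := rfl
    have q2 : q 2 = 1 := rfl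
    have q3 : q 3 = 0 := rfl
    rw [q0, q1, q2, q3] at h4
    linarith
  have h5 : (Polynomial.derivative (Ph F)).eval (-(gr + 1)) = g 0 := by
    have e : ln q ![1, 0, 0, 0] F = (Ph F).comp (Polynomial.X + Polynomial.C (-(gr + 1))) := by
      apply Polynomial.funext
      intro e
      rw [Polynomial.eval_comp, eval_ln, eval_Ph]
      congr 2
      funext i; fin_cases i <;> simp [hq]; ring
    have h4 := congrArg (fun p => (Polynomial.derivative p).eval 0) e
    simp only [deriv_ln, Fin.sum_univ_four, Polynomial.derivative_comp] at h4
    change _ * g 0 + _ * g 1 + _ * g 2 + _ * g 3 = _ at h4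
    simp at h4
    rw [h4]
    congr 1
    ring
  rw [h5, eval_Ph, ← hq]
  linarith

noncomputable def rr : ℝ := -(846 * gr + 522) / ((3 * gr + 2) * (42 * gr + 24))

theorem Ph_form {F : P4} (hn : F.IsHomogeneous 72) (hF : InvG F)
    (hmm : F ∈ (Ideal.span {X 0, X 1, X 2} : Ideal P4) ^ 20) :
    ∃ α : ℝ, ∀ t : ℝ, eval ![t, 0, 1, 0] F =
      α * (t ^ 20 * (t ^ 4 - 3 * t ^ 2 + 1) ^ 7 * (1 + rr * t ^ 2 + t ^ 4)) := by
  have hg := gr_sq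
  have hp := gr_pos
  have hm := mult_roots hF hmm
  obtain ⟨K, hK⟩ := Ph_dvd hn hF hm
  have hdeg := Ph_deg hn hF hm
  have hWd : (Polynomial.X ^ 20 * (Polynomial.X ^ 4 - 3 * Polynomial.X ^ 2 + 1) ^ 7 :
      Polynomial ℝ).natDegree = 48 := by
    compute_degree!
  have hKd : K.natDegree < 5 := by
    by_cases h0 : K = 0
    · simp [h0]
    rw [hK, Polynomial.natDegree_mul (by intro h; rw [h] at hWd; simp at hWd) h0, hWd] at hdeg
    omega
  have hev : ∀ t : ℝ, (Ph F).eval t = t ^ 20 * (t ^ 4 - 3 * t ^ 2 + 1) ^ 7 * K.eval t := by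
    intro t; rw [hK]; simp
  have hKe : ∀ t : ℝ, K.eval t = K.coeff 0 + K.coeff 1 * t + K.coeff 2 * t ^ 2 + K.coeff 3 * t ^ 3
      + K.coeff 4 * t ^ 4 := by
    intro t
    rw [Polynomial.eval_eq_sum_range' hKd]
    simp [Finset.sum_range_succ]
  have heven : ∀ t : ℝ, (Ph F).eval (-t) = (Ph F).eval t := by
    intro t; rw [eval_Ph, eval_Ph, hF.m1]
  have ev2 : K.eval (-2) = K.eval 2 := by
    have := heven 2
    rw [hev, hev] at this
    norm_num at this
    exact this
  have ev3 : K.eval (-3) = K.eval 3 := by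
    have := heven 3
    rw [hev, hev] at this
    norm_num at this
    exact this
  have pal : K.eval 2 = 16 * K.eval (1 / 2) := by
    have := Ph_recip hn hF 2 (by norm_num)
    rw [hev, hev] at this
    norm_num at this
    norm_num
    linarith
  rw [hKe, hKe] at ev2 ev3 pal
  have k1 : K.coeff 1 = 0 := by linarith
  have k3 : K.coeff 3 = 0 := by linarith
  have k4 : K.coeff 4 = K.coeff 0 := by linarith
  set a := K.coeff 0
  set b := K.coeff 2
  have hPe : Ph F = Polynomial.X ^ 20 * (Polynomial.X ^ 4 - 3 * Polynomial.X ^ 2 + 1) ^ 7 *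
      (Polynomial.C a + Polynomial.C b * Polynomial.X ^ 2 + Polynomial.C a * Polynomial.X ^ 4) := by
    apply Polynomial.funext
    intro t
    rw [hev, hKe, k1, k3, k4]
    simp
  have hgrad := Ph_grad hn hF
  have hlin : (846 * gr + 522) * a + (3 * gr + 2) * (42 * gr + 24) * b = 0 := by
    rw [hPe] at hgrad
    set t : ℝ := -(gr + 1) with ht
    have e2 : t ^ 2 = 3 * gr + 2 := by rw [ht]; linear_combination hg
    have e4 : t ^ 4 = 21 * gr + 13 := by
      have : t ^ 4 = t ^ 2 * t ^ 2 := by ring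
      rw [this, e2]; linear_combination 9 * hg
    have ht0 : t ≠ 0 := by rw [ht]; intro h; linarith
    have hw : t ^ 4 - 3 * t ^ 2 + 1 = 12 * gr + 8 := by rw [e2, e4]; ring
    have hw0 : (12 * gr + 8 : ℝ) ≠ 0 := by positivity
    simp [Polynomial.derivative_mul, Polynomial.derivative_pow] at hgrad
    rw [hw] at hgrad
    have h6 : t ^ 18 * ((12 * gr + 8) ^ 6 * (((20 * t * (12 * gr + 8) + 7 * t ^ 2 * (4 * t ^ 3 - 6 * t)) *
        (a + b * t ^ 2 + a * t ^ 4)) + t ^ 2 * (12 * gr + 8) * (2 * b * t + 4 * a * t ^ 3) +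
        24 * t ^ 2 * (12 * gr + 8) * (a + b * t ^ 2 + a * t ^ 4))) = 0 := by
      linear_combination hgrad
    have h7 := (mul_eq_zero.mp ((mul_eq_zero.mp h6).resolve_left (pow_ne_zero _ ht0))).resolve_left
      (pow_ne_zero _ hw0)
    have h8 : t * ((20 * (12 * gr + 8) + 7 * (t ^ 2 * (4 * t ^ 2 - 6))) *
        (a + b * t ^ 2 + a * t ^ 4) + (12 * gr + 8) * (2 * b * t ^ 2 + 4 * a * t ^ 4) +
        24 * t * (12 * gr + 8) * (a + b * t ^ 2 + a * t ^ 4)) = 0 := by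
      linear_combination h7
    have h9 := (mul_eq_zero.mp h8).resolve_left ht0
    rw [e2, e4, ht] at h9
    ring_nf at h9
    have g2 : gr ^ 2 = gr + 1 := by rw [sq]; exact hg
    have g3 : gr ^ 3 = 2 * gr + 1 := by
      have : gr ^ 3 = gr ^ 2 * gr := by ring
      rw [this, g2]; linear_combination hg
    have g4 : gr ^ 4 = 3 * gr + 2 := by
      have : gr ^ 4 = gr ^ 2 * gr ^ 2 := by ring
      rw [this, g2]; linear_combination hg
    simp only [g2, g3, g4] at h9
    ring_nf
    rw [g2]
    linarith
  have hb : b = rr * a := by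
    rw [rr]
    have : (3 * gr + 2) * (42 * gr + 24) ≠ 0 := by positivity
    field_simp
    linarith
  refine ⟨a, fun t => ?_⟩
  rw [← eval_Ph, hev, hKe, k1, k3, k4, hb]
  ring

theorem uniq {F F' : P4} (h0 : F ≠ 0) (hn : F.IsHomogeneous 72) (hF : InvG F)
    (hm : F ∈ (Ideal.span {X 0, X 1, X 2} : Ideal P4) ^ 20) (hn' : F'.IsHomogeneous 72)
    (hF' : InvG F') (hm' : F' ∈ (Ideal.span {X 0, X 1, X 2} : Ideal P4) ^ 20) :
    ∃ c : ℝ, F' = c • F := by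
  obtain ⟨a, ha⟩ := Ph_form hn hF hm
  obtain ⟨a', ha'⟩ := Ph_form hn' hF' hm'
  have ha0 : a ≠ 0 := by
    rintro rfl
    apply h0
    apply inj hn hF hm
    intro t
    rw [ha]; ring
  refine ⟨a' / a, ?_⟩
  rw [← sub_eq_zero, MvPolynomial.smul_eq_C_mul]
  apply inj
  · exact hn'.sub (by simpa using (MvPolynomial.isHomogeneous_C (Fin 4) (a' / a)).mul hn)
  · intro k v
    simp only [map_sub, map_mul, eval_C, hF k, hF' k]
  · exact Ideal.sub_mem _ hm' (Ideal.mul_mem_left _ _ hm)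
  · intro t
    rw [map_sub, map_mul, eval_C, ha, ha']
    field_simp
    ring

end H4

namespace H4

/-! ### the power sums and their invariance -/

def zpos (x : Int) (e : Bool) : Bool := if x = 0 then e else decide (0 < x)

def cn (v : V4) : V4 :=
  if zpos v.x.a (zpos v.x.b (zpos v.y.a (zpos v.y.b (zpos v.z.a (zpos v.z.b (zpos v.w.a true))))))
  then v else vneg v

def perm_ok (k : Nat) : Bool :=
  ((roots.map (ap2 k)).map cn).isPerm ((roots.map dbl).map cn)

theorem perm_ok_all : (perm_ok 0 && perm_ok 1 && perm_ok 2 && perm_ok 3) = true := by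
  decide +kernel

theorem perm_gen (k : Fin 4) :
    ((roots.map (ap2 k)).map cn).Perm ((roots.map dbl).map cn) := by
  have h := perm_ok_all
  simp only [Bool.and_eq_true] at h
  obtain ⟨⟨⟨h0, h1⟩, h2⟩, h3⟩ := h
  apply List.isPerm_iff.mp
  fin_cases k
  · exact h0
  · exact h1
  · exact h2
  · exact h3

noncomputable def pws (k : ℕ) : P4 := (roots.map (fun r => lin (vr r) ^ k)).sum

theorem eval_pws (k : ℕ) (v : Fin 4 → ℝ) :
    eval v (pws k) = (roots.map (fun r => (vr r ⬝ᵥ v) ^ k)).sum := by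
  rw [pws, map_list_sum, List.map_map]
  congr 1
  apply List.map_congr_left
  intro r _
  simp [eval_lin]

theorem gens_T (k : Fin 4) (u v : Fin 4 → ℝ) (n : ℕ) (hn : Even n) :
    (u ⬝ᵥ (gens k *ᵥ v)) ^ n = ((gens k *ᵥ u) ⬝ᵥ v) ^ n := by
  have h0 : ∀ u v : Fin 4 → ℝ, u ⬝ᵥ (m1 *ᵥ v) = (m1 *ᵥ u) ⬝ᵥ v := by
    intro u v
    rw [m1_mulVec, m1_mulVec]; simp [dotProduct, Fin.sum_univ_four]
  have h1 : ∀ u v : Fin 4 → ℝ, u ⬝ᵥ (m2 *ᵥ v) = (m2 *ᵥ u) ⬝ᵥ v := by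
    intro u v
    rw [m2_mulVec, m2_mulVec]; simp [dotProduct, Fin.sum_univ_four]
  have h2 : ∀ u v : Fin 4 → ℝ, u ⬝ᵥ (m3 *ᵥ v) = (m3 *ᵥ u) ⬝ᵥ v := by
    intro u v
    rw [m3_mulVec, m3_mulVec]; simp [dotProduct, Fin.sum_univ_four]; ring
  have h3 : ∀ u v : Fin 4 → ℝ, u ⬝ᵥ (m4 *ᵥ v) = - ((m4 *ᵥ u) ⬝ᵥ v) := by
    intro u v
    rw [m4_mulVec, m4_mulVec]; simp [dotProduct, Fin.sum_univ_four]; ring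
  fin_cases k
  · exact congrArg (· ^ n) (h0 u v)
  · exact congrArg (· ^ n) (h1 u v)
  · exact congrArg (· ^ n) (h2 u v)
  · exact (congrArg (· ^ n) (h3 u v)).trans (hn.neg_pow _)

theorem cn_pow (n : ℕ) (hn : Even n) (v : Fin 4 → ℝ) (r : V4) :
    (vr (cn r) ⬝ᵥ v) ^ n = (vr r ⬝ᵥ v) ^ n := by
  unfold cn
  split
  · rfl
  · rw [vr_neg, neg_dotProduct, hn.neg_pow]

theorem pws_inv (n : ℕ) (hn : Even n) : InvG (pws n) := by
  intro k v
  rw [eval_pws, eval_pws]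
  have h := (perm_gen k).map (fun r => (vr r ⬝ᵥ v) ^ n)
  have h := h.sum_eq
  rw [List.map_map, List.map_map, List.map_map, List.map_map] at h
  have e1 : ∀ r : V4, (((fun r => (vr r ⬝ᵥ v) ^ n) ∘ cn) ∘ ap2 k) r =
      2 ^ n * (vr r ⬝ᵥ (gens k *ᵥ v)) ^ n := by
    intro r
    simp only [Function.comp]
    rw [cn_pow n hn, vr_ap2, gens_T k _ _ n hn, ← mul_pow]
    congr 1
    simp only [dotProduct, Finset.mul_sum, mul_assoc]
  have e2 : ∀ r : V4, (((fun r => (vr r ⬝ᵥ v) ^ n) ∘ cn) ∘ dbl) r =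
      2 ^ n * (vr r ⬝ᵥ v) ^ n := by
    intro r
    simp only [Function.comp]
    rw [cn_pow n hn, vr_dbl, ← mul_pow]
    congr 1
    simp only [dotProduct, Finset.mul_sum, mul_assoc]
  rw [funext e1, funext e2, List.sum_map_mul_left, List.sum_map_mul_left] at h
  exact mul_left_cancel₀ (pow_ne_zero n two_ne_zero) h

theorem list_homog (l : List P4) (n : ℕ) (h : ∀ p ∈ l, p.IsHomogeneous n) :
    l.sum.IsHomogeneous n := by
  induction l with
  | nil => simpa using MvPolynomial.isHomogeneous_zero (Fin 4) ℝ n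
  | cons a l ih =>
    rw [List.sum_cons]
    exact (h a (by simp)).add (ih (fun p hp => h p (by simp [hp])))

theorem pws_homog (n : ℕ) : (pws n).IsHomogeneous n := by
  apply list_homog
  intro p hp
  rw [List.mem_map] at hp
  obtain ⟨r, _, rfl⟩ := hp
  simpa using (lin_homog (vr r)).pow n

noncomputable def qd : P4 := C 4 * (X 0 ^ 2 + X 1 ^ 2 + X 2 ^ 2 + X 3 ^ 2)

theorem qd_homog : qd.IsHomogeneous 2 := by
  have : ∀ i : Fin 4, (X i ^ 2 : P4).IsHomogeneous 2 := fun i => by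
    simpa using (MvPolynomial.isHomogeneous_X ℝ i).pow 2
  rw [qd]
  simpa using (MvPolynomial.isHomogeneous_C (Fin 4) (4 : ℝ)).mul
    ((((this 0).add (this 1)).add (this 2)).add (this 3))

theorem qd_eval (v : Fin 4 → ℝ) : eval v qd = 4 * (v ⬝ᵥ v) := by
  simp [qd, dotProduct, Fin.sum_univ_four]; ring

theorem qd_inv : InvG qd := by
  intro k v
  rw [qd_eval, qd_eval, Matrix.dotProduct_mulVec, ← Matrix.mulVec_transpose, Matrix.mulVec_mulVec,
    gens_orth, Matrix.one_mulVec]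

noncomputable def G : Fin 4 → P4 := ![qd, pws 12, pws 20, pws 30]

/-! ### polynomial expressions in the basic invariants -/

inductive Ex where
  | v : Fin 4 → Ex
  | c : Int → Ex
  | add : Ex → Ex → Ex
  | mul : Ex → Ex → Ex

def Ex.ev {R : Type*} [CommRing R] (g : Fin 4 → R) : Ex → R
  | .v i => g i
  | .c n => (n : R)
  | .add a b => a.ev g + b.ev g
  | .mul a b => a.ev g * b.ev g

theorem Ex.map {R S : Type*} [CommRing R] [CommRing S] (f : R →+* S) (g : Fin 4 → R) (e : Ex) :
    f (e.ev g) = e.ev (fun i => f (g i)) := by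
  induction e with
  | v i => rfl
  | c n => simp [Ex.ev]
  | add a b ha hb => simp [Ex.ev, ha, hb]
  | mul a b ha hb => simp [Ex.ev, ha, hb]

def Ex.deg : Ex → Option Nat
  | .v i => some (match i with | 0 => 2 | 1 => 12 | 2 => 20 | 3 => 30)
  | .c _ => some 0
  | .add a b => match a.deg, b.deg with
    | some m, some n => if m = n then some m else none
    | _, _ => none
  | .mul a b => match a.deg, b.deg with
    | some m, some n => some (m + n)
    | _, _ => none

theorem Ex.homog (e : Ex) : ∀ n, e.deg = some n → (e.ev G).IsHomogeneous n := by
  induction e with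
  | v i =>
    intro n h
    simp only [Ex.deg, Option.some.injEq] at h
    subst h
    fin_cases i
    · exact qd_homog
    · exact pws_homog 12
    · exact pws_homog 20
    · exact pws_homog 30
  | c k =>
    intro n h
    simp only [Ex.deg, Option.some.injEq] at h
    subst h
    have := MvPolynomial.isHomogeneous_C (Fin 4) (k : ℝ)
    simpa [Ex.ev] using this
  | add a b ha hb =>
    intro n h
    simp only [Ex.deg] at h
    split at h
    · rename_i m k h1 h2
      split at h
      · rename_i hmk
        simp only [Option.some.injEq] at h
        subst h; subst hmk
        exact (ha _ h1).add (hb _ h2)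
      · simp at h
    · simp at h
  | mul a b ha hb =>
    intro n h
    simp only [Ex.deg] at h
    split at h
    · rename_i m k h1 h2
      simp only [Option.some.injEq] at h
      subst h
      exact (ha _ h1).mul (hb _ h2)
    · simp at h

theorem G_inv (i : Fin 4) : InvG (G i) := by
  fin_cases i
  · exact qd_inv
  · exact pws_inv 12 (by decide)
  · exact pws_inv 20 (by decide)
  · exact pws_inv 30 (by decide)

theorem Ex.inv (e : Ex) : InvG (e.ev G) := by
  intro k v
  have h1 := Ex.map (eval (gens k *ᵥ v)) G e
  have h2 := Ex.map (eval v) G e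
  rw [h1, h2]
  congr 1
  funext i
  exact G_inv i k v

/-! ### the expansion at the point `(0,0,0,1)` -/

noncomputable def pn (F : P4) (n : ℕ) : P4 :=
  ∑ m ∈ F.support.filter (fun m => m 0 + m 1 + m 2 = n),
    C (F.coeff m) * (X 0 ^ m 0 * X 1 ^ m 1 * X 2 ^ m 2)

theorem pn_homog (F : P4) (n : ℕ) : (pn F n).IsHomogeneous n := by
  apply MvPolynomial.IsHomogeneous.sum
  intro m hm
  rw [Finset.mem_filter] at hm
  have hX : ∀ (i : Fin 4) (k : ℕ), (X i ^ k : P4).IsHomogeneous k := fun i k => by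
    simpa using (MvPolynomial.isHomogeneous_X ℝ i).pow k
  have := (MvPolynomial.isHomogeneous_C (Fin 4) (F.coeff m)).mul
    (((hX 0 (m 0)).mul (hX 1 (m 1))).mul (hX 2 (m 2)))
  rwa [hm.2, zero_add] at this

theorem pn_mem (F : P4) (n : ℕ) : pn F n ∈ (Ideal.span {X 0, X 1, X 2} : Ideal P4) ^ n := by
  apply Ideal.sum_mem
  intro m hm
  rw [Finset.mem_filter] at hm
  apply Ideal.mul_mem_left
  rw [← hm.2, pow_add, pow_add]
  refine Ideal.mul_mem_mul (Ideal.mul_mem_mul ?_ ?_) ?_ <;> apply Ideal.pow_mem_pow <;>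
    apply Ideal.subset_span <;> simp

theorem pn_sum {F : P4} {N : ℕ} (hF : F.IsHomogeneous N) :
    F = ∑ n ∈ Finset.range (N + 1), X 3 ^ (N - n) * pn F n := by
  have hs : ∀ m ∈ F.support, m 0 + m 1 + m 2 + m 3 = N := fun m hm => by
    have := homog_sum hF hm
    omega
  have h1 : F = ∑ m ∈ F.support, X 3 ^ (N - (m 0 + m 1 + m 2)) *
      (C (F.coeff m) * (X 0 ^ m 0 * X 1 ^ m 1 * X 2 ^ m 2)) := by
    conv_lhs => rw [F.as_sum]
    apply Finset.sum_congr rfl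
    intro m hm
    have : N - (m 0 + m 1 + m 2) = m 3 := by have := hs m hm; omega
    rw [this, MvPolynomial.monomial_eq, Finsupp.prod_fintype _ _ (by simp), Fin.prod_univ_four]
    ring
  conv_lhs => rw [h1]
  rw [← Finset.sum_fiberwise_of_maps_to (t := Finset.range (N + 1))
    (g := fun m => m 0 + m 1 + m 2)]
  · apply Finset.sum_congr rfl
    intro n _
    rw [pn, Finset.mul_sum]
    apply Finset.sum_congr rfl
    intro m hm
    rw [Finset.mem_filter] at hm
    rw [hm.2]
  · intro m hm
    have := hs m hm
    rw [Finset.mem_range]; omega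

theorem mem_of_pn {F : P4} {N : ℕ} (hF : F.IsHomogeneous N) (h : ∀ n < 20, pn F n = 0) :
    F ∈ (Ideal.span {X 0, X 1, X 2} : Ideal P4) ^ 20 := by
  rw [pn_sum hF]
  apply Ideal.sum_mem
  intro n _
  apply Ideal.mul_mem_left
  by_cases hn : n < 20
  · rw [h n hn]; exact Ideal.zero_mem _
  · exact Ideal.pow_le_pow_right (not_lt.mp hn) (pn_mem F n)

theorem pn_eval (F : P4) (n : ℕ) (v : Fin 4 → ℝ) :
    eval v (pn F n) = (ln ![0, 0, 0, 1] ![v 0, v 1, v 2, 0] F).coeff n := by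
  have h : ln ![0, 0, 0, 1] ![v 0, v 1, v 2, 0] F = ∑ m ∈ F.support,
      Polynomial.C (F.coeff m * (v 0 ^ m 0 * v 1 ^ m 1 * v 2 ^ m 2)) *
        Polynomial.X ^ (m 0 + m 1 + m 2) := by
    apply Polynomial.funext
    intro t
    rw [eval_ln, MvPolynomial.eval_eq', Polynomial.eval_finsetSum]
    apply Finset.sum_congr rfl
    intro m _
    simp [Fin.prod_univ_four]
    ring
  rw [h, Polynomial.finsetSum_coeff, pn, map_sum, Finset.sum_filter]
  apply Finset.sum_congr rfl
  intro m _
  rw [Polynomial.coeff_C_mul_X_pow]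
  by_cases hm : n = m 0 + m 1 + m 2
  · simp [hm]
  · rw [if_neg hm, if_neg (fun h => hm h.symm)]

theorem pn_inv {F : P4} (hF : InvG F) (n : ℕ) : InvH (pn F n) := by
  intro k hk v
  rw [pn_eval, pn_eval]
  congr 1
  apply Polynomial.funext
  intro t
  rw [eval_ln, eval_ln, ← hF k (fun i => ![0, 0, 0, 1] i + ![v 0, v 1, v 2, 0] i * t)]
  congr 2
  fin_cases k
  · change _ = m1 *ᵥ _
    change (fun i => _ + ![(m1 *ᵥ v) 0, (m1 *ᵥ v) 1, (m1 *ᵥ v) 2, 0] i * t) = _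
    rw [m1_mulVec, m1_mulVec]
    funext i; fin_cases i <;> simp
  · change _ = m2 *ᵥ _
    change (fun i => _ + ![(m2 *ᵥ v) 0, (m2 *ᵥ v) 1, (m2 *ᵥ v) 2, 0] i * t) = _
    rw [m2_mulVec, m2_mulVec]
    funext i; fin_cases i <;> simp
  · change _ = m3 *ᵥ _
    change (fun i => _ + ![(m3 *ᵥ v) 0, (m3 *ᵥ v) 1, (m3 *ᵥ v) 2, 0] i * t) = _
    rw [m3_mulVec, m3_mulVec]
    funext i; fin_cases i <;> simp <;> ring
  · simp at hk

theorem pn_line_deg (F : P4) (n : ℕ) :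
    (ln ![0, 0, 1, 0] ![1, 0, 0, 0] (pn F n)).natDegree ≤ n := by
  rw [pn, map_sum]
  apply Polynomial.natDegree_sum_le_of_forall_le
  intro m hm
  rw [Finset.mem_filter] at hm
  have h : ln ![0, 0, 1, 0] ![1, 0, 0, 0] (C (F.coeff m) * (X 0 ^ m 0 * X 1 ^ m 1 * X 2 ^ m 2)) =
      Polynomial.C (F.coeff m * 0 ^ m 1) * Polynomial.X ^ m 0 := by
    apply Polynomial.funext
    intro t
    rw [eval_ln]
    simp
    ring
  rw [h]
  exact (Polynomial.natDegree_C_mul_X_pow_le _ _).trans (by omega)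

theorem pn_zero {F : P4} (hF : InvG F) (n : ℕ) (hn : n < 20)
    (h : ∀ j : ℕ, j ≤ 10 → Polynomial.X ^ 20 ∣ ln ![0, 0, 0, 1] ![(j : ℝ), 0, 1, 0] F) :
    pn F n = 0 := by
  have hI := pn_inv hF n
  have ev0 : ∀ v : Fin 4 → ℝ, ∀ x, eval ![v 0, v 1, v 2, x] (pn F n) = eval v (pn F n) := by
    intro v x
    rw [pn_eval, pn_eval]
    rfl
  have e1 : ∀ a b c d : ℝ, eval ![-a, b, c, d] (pn F n) = eval ![a, b, c, d] (pn F n) := by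
    intro a b c d
    have := hI 0 (by decide) ![a, b, c, d]
    change eval (m1 *ᵥ _) _ = _ at this
    rw [m1_mulVec] at this
    exact this
  have e2 : ∀ a b c d : ℝ, eval ![a, -b, c, d] (pn F n) = eval ![a, b, c, d] (pn F n) := by
    intro a b c d
    have := hI 1 (by decide) ![a, b, c, d]
    change eval (m2 *ᵥ _) _ = _ at this
    rw [m2_mulVec] at this
    exact this
  have hj : ∀ j : ℕ, j ≤ 10 → eval ![(j : ℝ), 0, 1, 0] (pn F n) = 0 := by
    intro j hj
    rw [pn_eval]
    obtain ⟨Q, hQ⟩ := h j hj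
    change (ln ![0, 0, 0, 1] ![(j : ℝ), 0, 1, 0] F).coeff n = 0
    rw [hQ, Polynomial.coeff_X_pow_mul', if_neg (by omega)]
  have hP : ln ![0, 0, 1, 0] ![1, 0, 0, 0] (pn F n) = 0 := by
    apply Polynomial.eq_zero_of_natDegree_lt_card_of_eval_eq_zero _
      (f := fun i : Fin 21 => (i.val : ℝ) - 10)
    · intro a b hab
      simp only [sub_left_inj, Nat.cast_inj] at hab
      exact Fin.ext hab
    · intro i
      rw [eval_ln]
      have : (fun i_1 : Fin 4 => (![0, 0, 1, 0] : Fin 4 → ℝ) i_1 +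
          (![1, 0, 0, 0] : Fin 4 → ℝ) i_1 * ((i.val : ℝ) - 10)) = ![(i.val : ℝ) - 10, 0, 1, 0] := by
        funext k; fin_cases k <;> simp
      rw [this]
      by_cases hi : 10 ≤ i.val
      · have := hj (i.val - 10) (by omega)
        rwa [Nat.cast_sub hi] at this
      · have := hj (10 - i.val) (by omega)
        rw [Nat.cast_sub (by omega), ← e1] at this
        push_cast at this
        rwa [neg_sub] at this
    · rw [Fintype.card_fin]
      exact lt_of_le_of_lt (pn_line_deg F n) (by omega)
  have hk : kill 1 (pn F n) = 0 := by
    have hX : (X 2 : P4) * kill 1 (pn F n) = 0 := by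
      apply MvPolynomial.funext
      intro v
      rw [map_mul, eval_X, eval_kill, update1, map_zero]
      by_cases hz : v 2 = 0
      · rw [hz, zero_mul]
      have h5 := eval_smul_homog (pn_homog F n) (v 2) ![v 0 / v 2, 0, 1, 0]
      have h6 : eval ![v 0 / v 2, 0, 1, 0] (pn F n) = 0 := by
        have := eval_ln ![0, 0, 1, 0] ![1, 0, 0, 0] (pn F n) (v 0 / v 2)
        rw [hP] at this
        rw [Polynomial.eval_zero] at this
        refine Eq.trans ?_ this.symm
        congr 2
        funext k; fin_cases k <;> simp
      rw [h6, mul_zero] at h5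
      rw [← ev0 ![v 0, 0, v 2, v 3] 0]
      have h7 : eval ![v 0, 0, v 2, 0] (pn F n) = 0 := by
        refine Eq.trans ?_ h5
        congr 2
        funext k; fin_cases k <;> simp; field_simp
      exact mul_eq_zero_of_right _ h7
    exact (mul_eq_zero.mp hX).resolve_left (MvPolynomial.X_ne_zero 2)
  apply zero_of_H3 hI (pn_homog F n) (by omega)
  apply X_sq_dvd
  · intro v hv
    have := congrArg (eval v) hk
    rw [eval_kill, map_zero] at this
    rw [← this, ← hv, Function.update_eq_self]
  · intro v
    rw [update1, e2, ← vec4]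

end H4

namespace H4

/-! ### forcing evaluation -/

def fN {α : Sort*} (n : Nat) (f : Nat → α) : α :=
  match n with
  | 0 => f 0
  | n + 1 => f (n + 1)

def fI {α : Sort*} (x : Int) (f : Int → α) : α :=
  match x with
  | .ofNat n => fN n (fun n => f (.ofNat n))
  | .negSucc n => fN n (fun n => f (.negSucc n))

def fZ {α : Sort*} (x : Zp) (f : Zp → α) : α := fI x.a (fun a => fI x.b (fun b => f ⟨a, b⟩))

def fL {α : Sort*} : List Zp → (List Zp → α) → α
  | [], f => f []
  | x :: l, f => fZ x (fun x => fL l (fun l => f (x :: l)))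

theorem fN_eq {α : Sort*} (n : Nat) (f : Nat → α) : fN n f = f n := by
  cases n <;> rfl

theorem fI_eq {α : Sort*} (n : Int) (f : Int → α) : fI n f = f n := by
  cases n with
  | ofNat n => exact fN_eq n (fun n => f (.ofNat n))
  | negSucc n => exact fN_eq n (fun n => f (.negSucc n))

theorem fZ_eq {α : Sort*} (n : Zp) (f : Zp → α) : fZ n f = f n := by
  rw [fZ, fI_eq, fI_eq]

theorem fL_eq {α : Sort*} (l : List Zp) : ∀ f : List Zp → α, fL l f = f l := by
  induction l with
  | nil => intro f; rfl
  | cons x l ih => intro f; rw [fL, fZ_eq, ih]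

/-! ### truncated even power series -/

def padd : List Zp → List Zp → List Zp
  | [], q => q
  | a :: p, [] => a :: p
  | a :: p, b :: q => zadd a b :: padd p q

def mulT : List Zp → List Zp → Nat → List Zp
  | [], _, _ => []
  | _ :: _, _, 0 => []
  | a :: p, q, n + 1 => padd ((q.take (n + 1)).map (zmul a)) (⟨0, 0⟩ :: mulT p q n)

noncomputable def toP : List Zp → Polynomial ℝ
  | [] => 0
  | a :: l => Polynomial.C (zr a) + Polynomial.X ^ 2 * toP l

theorem toP_add (p q : List Zp) : toP (padd p q) = toP p + toP q := by
  fun_induction padd p q with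
  | case1 q => simp [toP]
  | case2 a p => simp [toP]
  | case3 a p b q ih => rw [toP, toP, toP, ih, zr_add, Polynomial.C_add]; ring

theorem toP_smul (a : Zp) (q : List Zp) : toP (q.map (zmul a)) = Polynomial.C (zr a) * toP q := by
  induction q with
  | nil => simp [toP]
  | cons b q ih => rw [List.map_cons, toP, toP, ih, zr_mul, Polynomial.C_mul]; ring

theorem toP_take (q : List Zp) : ∀ n : ℕ,
    Polynomial.X ^ (2 * n) ∣ toP (q.take n) - toP q := by
  induction q with
  | nil => intro n; simp [toP]
  | cons b q ih =>
    intro n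
    cases n with
    | zero => simp
    | succ n =>
      rw [List.take_succ_cons, toP, toP]
      obtain ⟨k, hk⟩ := ih n
      refine ⟨k, ?_⟩
      rw [mul_add, pow_add]
      linear_combination Polynomial.X ^ 2 * hk

theorem toP_mulT (p : List Zp) (q : List Zp) : ∀ n : ℕ,
    Polynomial.X ^ (2 * n) ∣ toP (mulT p q n) - toP p * toP q := by
  induction p with
  | nil => intro n; simp [mulT, toP]
  | cons a p ih =>
    intro n
    cases n with
    | zero => simp
    | succ n =>
      rw [mulT, toP_add, toP_smul, toP, toP]
      obtain ⟨k, hk⟩ := ih n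
      obtain ⟨l, hl⟩ := toP_take q (n + 1)
      refine ⟨Polynomial.C (zr a) * l + k, ?_⟩
      have z0 : zr ⟨0, 0⟩ = 0 := by simp [zr]
      rw [z0, Polynomial.C_0]
      have : (Polynomial.X ^ (2 * (n + 1)) : Polynomial ℝ) =
        Polynomial.X ^ 2 * Polynomial.X ^ (2 * n) := by ring
      linear_combination Polynomial.C (zr a) * hl + Polynomial.X ^ 2 * hk - k * this

noncomputable def pq : Polynomial ℝ →+* Polynomial ℝ ⧸ Ideal.span {(Polynomial.X ^ 20 : Polynomial ℝ)} :=
  Ideal.Quotient.mk _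

theorem pq_eq {a b : Polynomial ℝ} : pq a = pq b ↔ Polynomial.X ^ 20 ∣ a - b := by
  rw [pq, Ideal.Quotient.eq, Ideal.mem_span_singleton]

def Ex.evL (g : Fin 4 → List Zp) : Ex → List Zp
  | .v i => g i
  | .c n => [⟨n, 0⟩]
  | .add a b => fL (a.evL g) (fun x => fL (b.evL g) (fun y => padd x y))
  | .mul a b => fL (a.evL g) (fun x => fL (b.evL g) (fun y => mulT x y 10))

theorem Ex.evL_spec (g : Fin 4 → List Zp) (e : Ex) :
    pq (toP (e.evL g)) = e.ev (fun i => pq (toP (g i))) := by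
  induction e with
  | v i => rfl
  | c n =>
    have : toP [⟨n, 0⟩] = (n : Polynomial ℝ) := by simp [toP, zr]
    rw [Ex.evL, Ex.ev, this, map_intCast]
  | add a b ha hb =>
    rw [Ex.evL, Ex.ev, fL_eq, fL_eq, toP_add, map_add, ha, hb]
  | mul a b ha hb =>
    rw [Ex.evL, Ex.ev, fL_eq, fL_eq, ← ha, ← hb, ← map_mul, pq_eq]
    exact toP_mulT _ _ 10

/-! ### power sums along a line -/

noncomputable def co (l : List Zp) (i : ℕ) : ℝ := zr (l.getD i ⟨0, 0⟩)

theorem zr_zero : zr ⟨0, 0⟩ = 0 := by simp [zr]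
theorem zr_one : zr ⟨1, 0⟩ = 1 := by simp [zr]

theorem co_nil (i : ℕ) : co [] i = 0 := by simp [co, zr_zero]
theorem co_cons_zero (a : Zp) (l) : co (a :: l) 0 = zr a := rfl
theorem co_cons_succ (a : Zp) (l) (i : ℕ) : co (a :: l) (i + 1) = co l i := rfl

theorem co_padd (p q : List Zp) (i : ℕ) : co (padd p q) i = co p i + co q i := by
  fun_induction padd p q generalizing i with
  | case1 q => simp [co_nil]
  | case2 a p => simp [co_nil]
  | case3 a p b q ih =>
    cases i with
    | zero => simp only [co_cons_zero, zr_add]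
    | succ i => simp only [co_cons_succ, ih]

theorem co_zip (p : List Zp) : ∀ (q : List Zp) (i : ℕ),
    co (List.zipWith zmul p q) i = co p i * co q i := by
  induction p with
  | nil => intro q i; simp [co_nil]
  | cons a p ih =>
    intro q i
    cases q with
    | nil => simp [co_nil]
    | cons b q =>
      rw [List.zipWith_cons_cons]
      cases i with
      | zero => simp only [co_cons_zero, zr_mul]
      | succ i => simp only [co_cons_succ, ih]

theorem toP_coeff (l : List Zp) : ∀ i, (toP l).coeff (2 * i) = co l i := by
  induction l with
  | nil => intro i; simp [toP, co_nil]
  | cons a l ih =>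
    intro i
    cases i with
    | zero => simp [toP, co_cons_zero]
    | succ i =>
      rw [toP, co_cons_succ, ← ih, Polynomial.coeff_add, Polynomial.coeff_C,
        if_neg (by omega), zero_add]
      exact Polynomial.coeff_X_pow_mul _ 2 (2 * i)

theorem toP_coeff_odd (l : List Zp) : ∀ i, (toP l).coeff (2 * i + 1) = 0 := by
  induction l with
  | nil => intro i; simp [toP]
  | cons a l ih =>
    intro i
    rw [toP, Polynomial.coeff_add, Polynomial.coeff_C, if_neg (by omega), zero_add,
      Polynomial.coeff_X_pow_mul']
    cases i with
    | zero => simp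
    | succ i =>
      rw [if_pos (by omega), ← ih i]
      congr 1

def geo (c : Zp) : Nat → Zp → List Zp
  | 0, _ => []
  | n + 1, a => fZ a (fun a => a :: geo c n (zmul a c))

def rgeo (c : Zp) : Nat → Zp → List Zp → List Zp
  | 0, a, l => fZ a (fun a => a :: l)
  | n + 1, a, l => fZ a (fun a => rgeo c n (zmul a c) (a :: l))

theorem co_geo (c : Zp) (n : ℕ) : ∀ (a : Zp) (i : ℕ), i < n → co (geo c n a) i = zr a * zr c ^ i := by
  induction n with
  | zero => intro a i h; omega
  | succ n ih =>
    intro a i h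
    rw [geo, fZ_eq]
    cases i with
    | zero => simp [co_cons_zero]
    | succ i => rw [co_cons_succ, ih _ _ (by omega), zr_mul]; ring

theorem co_rgeo (c : Zp) (m : ℕ) : ∀ (a : Zp) (l : List Zp) (i : ℕ), co (rgeo c m a l) i =
    if i ≤ m then zr a * zr c ^ (m - i) else co l (i - m - 1) := by
  induction m with
  | zero =>
    intro a l i
    rw [rgeo, fZ_eq]
    cases i with
    | zero => simp [co_cons_zero]
    | succ i => simp [co_cons_succ]
  | succ m ih =>
    intro a l i
    rw [rgeo, fZ_eq, ih]
    by_cases h1 : i ≤ m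
    · rw [if_pos h1, if_pos (by omega), zr_mul, Nat.sub_add_comm h1, pow_succ]; ring
    rw [if_neg h1]
    by_cases h2 : i = m + 1
    · subst h2; simp [co_cons_zero]
    · rw [if_neg (by omega)]
      have : i - m - 1 = (i - (m + 1) - 1) + 1 := by omega
      rw [this, co_cons_succ]

def slp (j : Nat) (r : V4) : Zp := zadd (zmul ⟨j, 0⟩ r.x) r.z

def tl (m j : Nat) (r : V4) : List Zp :=
  List.zipWith zmul
    (fZ (zmul r.w r.w) (fun W => rgeo W m ⟨1, 0⟩ []))
    (fZ (zmul (slp j r) (slp j r)) (fun S => geo S 10 ⟨1, 0⟩))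

theorem co_tl (m j : ℕ) (r : V4) (i : ℕ) (hi : i < 10) : co (tl m j r) i =
    if i ≤ m then zr r.w ^ (2 * m - 2 * i) * zr (slp j r) ^ (2 * i) else 0 := by
  rw [tl, co_zip, fZ_eq, fZ_eq, co_rgeo, co_geo _ _ _ _ hi, zr_one, zr_mul, zr_mul, co_nil]
  by_cases h : i ≤ m
  · rw [if_pos h, if_pos h, ← sq, ← sq, ← pow_mul, ← pow_mul, one_mul, one_mul, Nat.mul_sub]
  · rw [if_neg h, if_neg h, zero_mul]

def psl (m j : Nat) : List V4 → List Zp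
  | [] => []
  | r :: l => fL (psl m j l) (fun acc => padd (tl m j r) acc)

theorem co_psl (m j : ℕ) (i : ℕ) (hi : i < 10) (l : List V4) : co (psl m j l) i =
    (l.map (fun r => if i ≤ m then zr r.w ^ (2 * m - 2 * i) * zr (slp j r) ^ (2 * i) else 0)).sum := by
  induction l with
  | nil => simp [psl, co_nil]
  | cons r l ih => rw [psl, fL_eq, co_padd, co_tl m j r i hi, ih, List.map_cons, List.sum_cons]

def bl : Nat → List Zp
  | 6 => [⟨1, 0⟩, ⟨66, 0⟩, ⟨495, 0⟩, ⟨924, 0⟩, ⟨495, 0⟩, ⟨66, 0⟩, ⟨1, 0⟩]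
  | 10 => [⟨1, 0⟩, ⟨190, 0⟩, ⟨4845, 0⟩, ⟨38760, 0⟩, ⟨125970, 0⟩, ⟨184756, 0⟩, ⟨125970, 0⟩,
      ⟨38760, 0⟩, ⟨4845, 0⟩, ⟨190, 0⟩]
  | _ => [⟨1, 0⟩, ⟨435, 0⟩, ⟨27405, 0⟩, ⟨593775, 0⟩, ⟨5852925, 0⟩, ⟨30045015, 0⟩, ⟨86493225, 0⟩,
      ⟨145422675, 0⟩, ⟨145422675, 0⟩, ⟨86493225, 0⟩]

theorem co_bl (m : ℕ) (hm : m = 6 ∨ m = 10 ∨ m = 15) (i : ℕ) (hi : i < 10) :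
    co (bl m) i = ((2 * m).choose (2 * i) : ℕ) := by
  rcases hm with rfl | rfl | rfl <;> interval_cases i <;>
    simp [bl, co, zr, Nat.choose_eq_descFactorial_div_factorial, Nat.descFactorial, Nat.factorial]

def ps (m j : Nat) : List Zp := List.zipWith zmul (bl m) (psl m j roots)

theorem lin_line (j : ℕ) (r : V4) : ln ![0, 0, 0, 1] ![(j : ℝ), 0, 1, 0] (lin (vr r)) =
    Polynomial.C (zr (slp j r)) * Polynomial.X + Polynomial.C (zr r.w) := by
  apply Polynomial.funext
  intro t
  rw [eval_ln, eval_lin]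
  simp [dotProduct, Fin.sum_univ_four, vr, slp, zr_add, zr_mul]
  simp [zr]; ring

theorem line_odd (j : ℕ) (n : ℕ) (hn : Even n) (i : ℕ) (hi : Odd i) :
    (ln ![0, 0, 0, 1] ![(j : ℝ), 0, 1, 0] (pws n)).coeff i = 0 := by
  set P := ln ![0, 0, 0, 1] ![(j : ℝ), 0, 1, 0] (pws n) with hP
  have h : P.comp (Polynomial.C (-1) * Polynomial.X) = P := by
    apply Polynomial.funext
    intro t
    rw [Polynomial.eval_comp, hP, eval_ln, eval_ln]
    have h1 := eval_smul_homog (pws_homog n) (-1) ![(j : ℝ) * t, 0, t, -1]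
    rw [hn.neg_one_pow, one_mul, (pws_inv n hn).flipw] at h1
    have e1 : (fun i : Fin 4 => (-1 : ℝ) * ![(j : ℝ) * t, 0, t, -1] i) = fun i =>
        (![0, 0, 0, 1] : Fin 4 → ℝ) i + (![(j : ℝ), 0, 1, 0] : Fin 4 → ℝ) i *
          Polynomial.eval t (Polynomial.C (-1) * Polynomial.X) := by
      funext k; fin_cases k <;> simp
    have e2 : ![(j : ℝ) * t, 0, t, 1] = fun i =>
        (![0, 0, 0, 1] : Fin 4 → ℝ) i + (![(j : ℝ), 0, 1, 0] : Fin 4 → ℝ) i * t := by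
      funext k; fin_cases k <;> simp
    rw [e1, e2] at h1
    exact h1
  have h2 := congrArg (fun p => p.coeff i) h
  simp only [Polynomial.comp_C_mul_X_coeff] at h2
  rw [hi.neg_one_pow] at h2
  linarith

theorem line_even (j : ℕ) (n i : ℕ) :
    (ln ![0, 0, 0, 1] ![(j : ℝ), 0, 1, 0] (pws n)).coeff i =
    (n.choose i : ℝ) * (roots.map (fun r => zr r.w ^ (n - i) * zr (slp j r) ^ i)).sum := by
  rw [pws, map_list_sum, List.map_map, Polynomial.coeff_list_sum, List.map_map,
    ← List.sum_map_mul_left]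
  congr 1
  apply List.map_congr_left
  intro r _
  simp only [Function.comp]
  rw [map_pow, lin_line]
  have h1 : (Polynomial.C (zr (slp j r)) * Polynomial.X + Polynomial.C (zr r.w)) ^ n =
      ((Polynomial.X + Polynomial.C (zr r.w)) ^ n).comp
        (Polynomial.C (zr (slp j r)) * Polynomial.X) := by
    simp
  rw [h1, Polynomial.lcoeff_apply, Polynomial.comp_C_mul_X_coeff, Polynomial.coeff_X_add_C_pow]
  ring

theorem ps_spec (m j : ℕ) (hm : m = 6 ∨ m = 10 ∨ m = 15) :
    pq (ln ![0, 0, 0, 1] ![(j : ℝ), 0, 1, 0] (pws (2 * m))) = pq (toP (ps m j)) := by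
  rw [pq_eq, Polynomial.X_pow_dvd_iff]
  intro d hd
  rw [Polynomial.coeff_sub, sub_eq_zero]
  rcases Nat.even_or_odd' d with ⟨i, rfl | rfl⟩
  · rw [toP_coeff, line_even, ps, co_zip, co_psl _ _ _ (by omega), co_bl m hm i (by omega)]
    by_cases h : i ≤ m
    · simp only [if_pos h]
    · rw [Nat.choose_eq_zero_of_lt (by omega)]; simp
  · rw [toP_coeff_odd, line_odd j _ (even_two_mul m) _ ⟨i, rfl⟩]

/-! ### the degree 72 invariant -/

def Ex.pm (x : Ex) : Nat → Ex → Ex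
  | 0, e => e
  | n + 1, e => .mul x (x.pm n e)

/-- rows `(s, b, c, d, k)`: add `k * f12^b * f20^c * f30^d`, then multiply by `q^s` -/
def rows : List (Nat × Nat × Nat × Nat × Int) := [
  (6, 0, 0, 0, 199315604842600931862965399939630625),
  (4, 1, 0, 0, -214002679615024062638478940646400000),
  (2, 0, 1, 0, 14969948637010050882213930270720000),
  (3, 2, 0, 0, 57659850548647252241130556489728000),
  (1, 0, 0, 1, -143753366164669691057947017216000),
  (2, 1, 1, 0, -7995300202431728063689330262016000),
  (2, 3, 0, 0, -121075092831851425170537106636800),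
  (1, 0, 2, 0, 281086072477478398702166999040000),
  (1, 1, 0, 1, 77173098381366064774517882880000),
  (2, 2, 1, 0, -13987131485870907008879689728000),
  (1, 4, 0, 0, 2561419195164592608131835494400),
  (1, 0, 1, 1, -5398424547796490379721703424000),
  (1, 1, 2, 0, 1548077627676934741243723776000),
  (1, 2, 0, 1, -78199308682651847724997017600),
  (2, 3, 1, 0, -152626152969882709107985612800),
  (0, 5, 0, 0, -2535714544584855833259540480),
  (1, 0, 0, 2, 25919985417088550299081113600),
  (1, 1, 1, 1, -14865873989212550906825932800),
  (1, 2, 2, 0, 2131503991100328990316953600),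
  (1, 3, 0, 1, 1680978646096899180393922560),
  (2, 4, 1, 0, -482045347042493147318845440),
  (0, 6, 0, 0, 27253962175947458366930944)]

def build : List (Nat × Nat × Nat × Nat × Int) → Ex → Ex
  | [], e => e
  | (s, b, c, d, k) :: l, e =>
    build l ((Ex.v 0).pm s (.add e ((Ex.v 1).pm b ((Ex.v 2).pm c ((Ex.v 3).pm d (.c k))))))

def FE : Ex := build rows (.c 0)

def lst (j : Nat) : Fin 4 → List Zp :=
  ![[⟨4, 0⟩, ⟨4 * (j * j + 1), 0⟩], ps 6 j, ps 10 j, ps 15 j]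

def ckE (e : Ex) (j : Nat) : Bool :=
  fL (ps 6 j) (fun l1 => fL (ps 10 j) (fun l2 => fL (ps 15 j) (fun l3 =>
    (e.evL ![[⟨4, 0⟩, ⟨4 * (j * j + 1), 0⟩], l1, l2, l3]).all (fun x => decide (x = ⟨0, 0⟩)))))

def ck (j : Nat) : Bool := ckE FE j

attribute [local irreducible] ps pws roots FE

theorem G1 : G 1 = pws (2 * 6) := rfl
theorem G2 : G 2 = pws (2 * 10) := rfl
theorem G3 : G 3 = pws (2 * 15) := rfl

theorem lst_spec (j : ℕ) (i : Fin 4) :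
    pq (ln ![0, 0, 0, 1] ![(j : ℝ), 0, 1, 0] (G i)) = pq (toP (lst j i)) := by
  fin_cases i
  · change pq (ln _ _ qd) = pq (toP [⟨4, 0⟩, ⟨4 * (j * j + 1), 0⟩])
    congr 1
    apply Polynomial.funext
    intro t
    rw [eval_ln, qd_eval]
    simp [dotProduct, Fin.sum_univ_four, toP, zr]
    ring
  · exact (congrArg (fun p => pq (ln ![0, 0, 0, 1] ![(j : ℝ), 0, 1, 0] p)) G1).trans
      (ps_spec 6 j (Or.inl rfl))
  · exact (congrArg (fun p => pq (ln ![0, 0, 0, 1] ![(j : ℝ), 0, 1, 0] p)) G2).trans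
      (ps_spec 10 j (Or.inr (Or.inl rfl)))
  · exact (congrArg (fun p => pq (ln ![0, 0, 0, 1] ![(j : ℝ), 0, 1, 0] p)) G3).trans
      (ps_spec 15 j (Or.inr (Or.inr rfl)))

theorem toP_all (l : List Zp) (h : l.all (fun x => decide (x = ⟨0, 0⟩)) = true) : toP l = 0 := by
  induction l with
  | nil => rfl
  | cons a l ih =>
    rw [List.all_cons, Bool.and_eq_true, decide_eq_true_eq] at h
    rw [toP, ih h.2, h.1, zr_zero]
    simp

theorem ckE_eq (e : Ex) (j : ℕ) :
    ckE e j = (e.evL (lst j)).all (fun x => decide (x = ⟨0, 0⟩)) := by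
  unfold ckE lst
  simp only [fL_eq]

theorem ckE_spec (e : Ex) (j : ℕ) (h : ckE e j = true) :
    Polynomial.X ^ 20 ∣ ln ![0, 0, 0, 1] ![(j : ℝ), 0, 1, 0] (e.ev G) := by
  have h := (ckE_eq e j).symm.trans h
  have h1 := Ex.evL_spec (lst j) e
  rw [toP_all _ h] at h1
  have h2 := Ex.map (pq.comp (ln ![0, 0, 0, 1] ![(j : ℝ), 0, 1, 0]).toRingHom) G e
  have h3 : (fun i => (pq.comp (ln ![0, 0, 0, 1] ![(j : ℝ), 0, 1, 0]).toRingHom) (G i)) =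
      fun i => pq (toP (lst j i)) := by
    funext i
    exact lst_spec j i
  rw [h3, ← h1] at h2
  have h4 := pq_eq.mp h2
  rwa [sub_zero] at h4

theorem ck_spec (j : ℕ) (h : ck j = true) :
    Polynomial.X ^ 20 ∣ ln ![0, 0, 0, 1] ![(j : ℝ), 0, 1, 0] (FE.ev G) := by
  unfold ck at h
  exact ckE_spec FE j h

theorem ck_0 : ck 0 = true := by decide +kernel
theorem ck_1 : ck 1 = true := by decide +kernel
theorem ck_2 : ck 2 = true := by decide +kernel
theorem ck_3 : ck 3 = true := by decide +kernel
theorem ck_4 : ck 4 = true := by decide +kernel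
theorem ck_5 : ck 5 = true := by decide +kernel
theorem ck_6 : ck 6 = true := by decide +kernel
theorem ck_7 : ck 7 = true := by decide +kernel
theorem ck_8 : ck 8 = true := by decide +kernel
theorem ck_9 : ck 9 = true := by decide +kernel
theorem ck_10 : ck 10 = true := by decide +kernel

theorem ck_all (j : ℕ) (hj : j ≤ 10) : ck j = true :=
  match j, hj with
  | 0, _ => ck_0
  | 1, _ => ck_1
  | 2, _ => ck_2
  | 3, _ => ck_3
  | 4, _ => ck_4
  | 5, _ => ck_5
  | 6, _ => ck_6
  | 7, _ => ck_7
  | 8, _ => ck_8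
  | 9, _ => ck_9
  | 10, _ => ck_10
  | n + 11, h => absurd h (by omega)

/-! ### non-vanishing -/

def zpw (c : Zp) : Nat → Zp
  | 0 => ⟨1, 0⟩
  | n + 1 => fZ (zpw c n) (fun y => zmul c y)

theorem zr_zpw (c : Zp) (n : ℕ) : zr (zpw c n) = zr c ^ n := by
  induction n with
  | zero => simp [zpw, zr_one]
  | succ n ih => rw [zpw, fZ_eq, zr_mul, ih, pow_succ']

def zps (k : Nat) : List V4 → Zp
  | [] => ⟨0, 0⟩
  | r :: l => fZ (zps k l) (fun y => fZ (slp 2 r) (fun s => zadd (zpw s k) y))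

theorem zr_zps (k : ℕ) : zr (zps k roots) = eval ![2, 0, 1, 0] (pws k) := by
  rw [eval_pws]
  induction roots with
  | nil => simp [zps, zr_zero]
  | cons r l ih =>
    rw [zps, fZ_eq, fZ_eq, zr_add, ih, zr_zpw, List.map_cons, List.sum_cons]
    congr 2
    simp [dotProduct, Fin.sum_univ_four, vr, slp, zr_add, zr_mul]
    simp [zr]; ring

attribute [local irreducible] zps

def Ex.evZ (g : Fin 4 → Zp) : Ex → Zp
  | .v i => g i
  | .c n => ⟨n, 0⟩
  | .add a b => fZ (a.evZ g) (fun x => fZ (b.evZ g) (fun y => zadd x y))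
  | .mul a b => fZ (a.evZ g) (fun x => fZ (b.evZ g) (fun y => zmul x y))

theorem Ex.evZ_spec (g : Fin 4 → Zp) (e : Ex) : zr (e.evZ g) = e.ev (fun i => zr (g i)) := by
  induction e with
  | v i => rfl
  | c n => simp [Ex.evZ, Ex.ev, zr]
  | add a b ha hb => rw [Ex.evZ, Ex.ev, fZ_eq, fZ_eq, zr_add, ha, hb]
  | mul a b ha hb => rw [Ex.evZ, Ex.ev, fZ_eq, fZ_eq, zr_mul, ha, hb]

def nzk (e : Ex) : Bool :=
  fZ (zps 12 roots) (fun a => fZ (zps 20 roots) (fun b => fZ (zps 30 roots) (fun c =>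
    fZ (e.evZ ![⟨20, 0⟩, a, b, c]) znz)))

theorem nzk_eq (e : Ex) : nzk e = znz (e.evZ ![⟨20, 0⟩, zps 12 roots, zps 20 roots, zps 30 roots]) := by
  unfold nzk
  simp only [fZ_eq]

theorem nzk_spec (e : Ex) (hk : nzk e = true) : e.ev G ≠ 0 := by
  intro h0
  have h := (nzk_eq e).symm.trans hk
  apply zr_ne h
  have h2 := Ex.map (eval ![2, 0, 1, 0]) G e
  rw [h0, map_zero] at h2
  refine (Ex.evZ_spec _ e).trans (Eq.trans ?_ h2.symm)
  congr 1
  funext i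
  revert i
  rw [Fin.forall_fin_succ, Fin.forall_fin_succ, Fin.forall_fin_succ, Fin.forall_fin_succ]
  refine ⟨?_, zr_zps 12, zr_zps 20, zr_zps 30, fun i => i.elim0⟩
  change zr ⟨20, 0⟩ = eval _ qd
  rw [qd_eval]
  simp [zr, dotProduct, Fin.sum_univ_four]
  norm_num

theorem nzk_true : nzk FE = true := by decide +kernel

theorem FE_ne : FE.ev G ≠ 0 := nzk_spec FE nzk_true

theorem FE_deg : FE.deg = some 72 := by decide +kernel

theorem FE_mem : FE.ev G ∈ (Ideal.span {X 0, X 1, X 2} : Ideal P4) ^ 20 :=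
  mem_of_pn (FE.homog 72 FE_deg)
    (fun n hn => pn_zero FE.inv n hn (fun j hj => ck_spec j (ck_all j hj)))

end H4

/-- The space of `W(H4)`-invariant homogeneous polynomials of degree 72 lying in
`(x,y,z)^{20}` is one-dimensional: it is spanned by a single nonzero polynomial. -/
theorem WH4_degree72_order20_unique :
    ∃ F : MvPolynomial (Fin 4) ℝ, F ≠ 0 ∧ F.IsHomogeneous 72 ∧
      (∀ g ∈ WH4, polyActR g F = F) ∧
      F ∈ (Ideal.span {X 0, X 1, X 2} : Ideal (MvPolynomial (Fin 4) ℝ)) ^ 20 ∧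
      ∀ F' : MvPolynomial (Fin 4) ℝ, F'.IsHomogeneous 72 →
        (∀ g ∈ WH4, polyActR g F' = F') →
        F' ∈ (Ideal.span {X 0, X 1, X 2} : Ideal (MvPolynomial (Fin 4) ℝ)) ^ 20 →
        ∃ c : ℝ, F' = c • F := by
  refine ⟨H4.FE.ev H4.G, H4.FE_ne, H4.FE.homog 72 H4.FE_deg, H4.of_invG H4.FE.inv, H4.FE_mem,
    fun F' h1 h2 h3 => ?_⟩
  exact H4.uniq H4.FE_ne (H4.FE.homog 72 H4.FE_deg) H4.FE.inv H4.FE_mem h1 (H4.invG_of h2) h3
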